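/- arXiv:2208.02535 — 2 statements merged into one kernel-verified Lean document; each statement's English description precedes it below -/
import Mathlib

section
/- Let p be a prime number and n < p-1 a natural number. Let (A,+,∘) be a left brace of cardinality p^n and let ann(p^4) = {a ∈ A : p^4·a = 0} (an ideal of A). Then there exists a left nilpotent pre-Lie ring structure (A/ann(p^4), +, ·) on the additive group of the factor brace A/ann(p^4) such that the multiplication ∘ of the factor brace A/ann(p^4) coincides with the multiplication of the group of flows of the pre-Lie ring (A/ann(p^4), +, ·); in particular the addition of this pre-Lie ring equals the addition of the factor brace. -/
universe u

/-- A left brace: `(A,+)` abelian group, `(A,∘)` a group, with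
`a∘(b+c)+a = a∘b+a∘c`. -/
structure LeftBrace (A : Type u) [AddCommGroup A] where
  circ : A → A → A
  one : A
  inv : A → A
  circ_assoc : ∀ a b c : A, circ (circ a b) c = circ a (circ b c)
  one_circ : ∀ a : A, circ one a = a
  circ_one : ∀ a : A, circ a one = a
  inv_circ : ∀ a : A, circ (inv a) a = one
  circ_add : ∀ a b c : A, circ a (b + c) + a = circ a b + circ a c

/-- `a*b = a∘b - a - b`. -/
def LeftBrace.star {A : Type u} [AddCommGroup A] (B : LeftBrace A) (a b : A) : A :=
  B.circ a b - a - b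

/-- `ann(k) = {a : k•a = 0}`, as an additive subgroup. -/
def annSub (A : Type u) [AddCommGroup A] (k : ℕ) : AddSubgroup A where
  carrier := {a : A | k • a = 0}
  zero_mem' := by simp
  add_mem' := by
    intro a b ha hb
    have ha' : k • a = 0 := ha
    have hb' : k • b = 0 := hb
    show k • (a + b) = 0
    rw [smul_add, ha', hb', add_zero]
  neg_mem' := by
    intro a ha
    have ha' : k • a = 0 := ha
    show k • (-a) = 0
    rw [smul_neg, ha', neg_zero]

/-- The coset `[a]` of `a` in `A/ann(k)`. -/
def qmk {A : Type u} [AddCommGroup A] (k : ℕ) (a : A) : A ⧸ annSub A k :=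
  QuotientAddGroup.mk a

/-- Evaluation of a non-associative word under a binary operation `op`,
substituting `f i` for the variable `i`. -/
def wEval {α : Type*} {β : Type*} (op : β → β → β) (f : α → β) : FreeMagma α → β
  | FreeMagma.of a => f a
  | FreeMagma.mul x y => op (wEval op f x) (wEval op f y)

/-- The list of leaves (occurrences of variables, left to right) of a word. -/
def wLeaves {α : Type*} : FreeMagma α → List α
  | FreeMagma.of a => [a]
  | FreeMagma.mul x y => wLeaves x ++ wLeaves y

/-- The last (rightmost) variable of a word. -/
def wLast {α : Type*} : FreeMagma α → α
  | FreeMagma.of a => a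
  | FreeMagma.mul _ y => wLast y

/-- The number of occurrences of the variable `a` in a word. -/
def wCount {α : Type*} [DecidableEq α] (a : α) : FreeMagma α → ℕ
  | FreeMagma.of b => if b = a then 1 else 0
  | FreeMagma.mul x y => wCount a x + wCount a y

/-- The length (number of variable occurrences) of a word. -/
def wLen {α : Type*} : FreeMagma α → ℕ
  | FreeMagma.of _ => 1
  | FreeMagma.mul x y => wLen x + wLen y

/-- Left-normed product `a₁·(a₂·(⋯(aₘ·b)⋯))`. -/
def leftProd {Q : Type*} (mul : Q → Q → Q) : List Q → Q → Q
  | [], b => b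
  | a :: l, b => mul a (leftProd mul l b)

/-- `circPow B a k` is the product of `k` copies of `a` under `∘`. -/
def circPow {A : Type u} [AddCommGroup A] (B : LeftBrace A) (a : A) : ℕ → A
  | 0 => B.one
  | k + 1 => B.circ a (circPow B a k)

/-- `eSeq B a (i-1)` is `a_i`, where `a_1 = a` and `a_{i+1} = a * a_i`. -/
def eSeq {A : Type u} [AddCommGroup A] (B : LeftBrace A) (a : A) : ℕ → A
  | 0 => a
  | i + 1 => B.star a (eSeq B a i)

/-- `starIter B a b (i-1)` is `e_i`, where `e_1 = a*b` and `e_{i+1} = a*e_i`. -/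
def starIter {A : Type u} [AddCommGroup A] (B : LeftBrace A) (a b : A) : ℕ → A
  | 0 => B.star a b
  | i + 1 => B.star a (starIter B a b i)

/-- `iterOp op u v i` is `u ⊙ (u ⊙ (⋯ (u ⊙ v)))` with `i` applications of `u ⊙ ·`. -/
def iterOp {Q : Type*} (op : Q → Q → Q) (u v : Q) : ℕ → Q
  | 0 => v
  | i + 1 => op u (iterOp op u v i)

/-- `f(a) = Σ_{i=1}^{p−1} (C(p−1,i−1)/i)·e_i` where `e_1 = a`, `e_{i+1} = a*e_i`. -/
def fMap {A : Type u} [AddCommGroup A] (B : LeftBrace A) (p : ℕ) (a : A) : A :=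
  ∑ i ∈ Finset.Icc 1 (p - 1), (Nat.choose (p - 1) (i - 1) / i) • eSeq B a (i - 1)

/-- `braceChainAux B (i-1)` is `A^i`: `A^1 = A`, `A^{i+1}` the additive subgroup
generated by `{x*y : x ∈ A, y ∈ A^i}`. -/
def braceChainAux {A : Type u} [AddCommGroup A] (B : LeftBrace A) : ℕ → AddSubgroup A
  | 0 => ⊤
  | i + 1 => AddSubgroup.closure {z : A | ∃ x : A, ∃ y ∈ braceChainAux B i, z = B.star x y}

/-- `dSeq B a b i = (d_i, d_i')`: `d_0 = a`, `d_0' = b`, `d_{i+1} = d_i + d_i'`,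
`d_{i+1}' = d_i * d_i'`. -/
def dSeq {A : Type u} [AddCommGroup A] (B : LeftBrace A) (a b : A) : ℕ → A × A
  | 0 => (a, b)
  | i + 1 => ((dSeq B a b i).1 + (dSeq B a b i).2, B.star (dSeq B a b i).1 (dSeq B a b i).2)

/-- A ring with a finite multiplicative filtration whose positive part is `p^m`-torsion. -/
structure Filt (R : Type*) [Ring R] (p m : ℕ) where
  F : ℕ → AddSubgroup R
  one_mem : (1 : R) ∈ F 0
  mul_mem : ∀ {i j : ℕ} {x y : R}, x ∈ F i → y ∈ F j → x * y ∈ F (i + j)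
  anti : ∀ {i j : ℕ}, i ≤ j → F j ≤ F i
  top : F p = ⊥
  tors : ∀ x ∈ F 1, p ^ m • x = 0

/-- Inverse of `k!` modulo `p^m`. -/
noncomputable def ifac (p m k : ℕ) : ℕ :=
  if k ≤ 1 then 1 else ((k.factorial : ZMod (p ^ m))⁻¹).val

lemma ifac_spec {p m k : ℕ} (hp : p.Prime) (hk : k < p) :
    ((ifac p m k : ℕ) : ZMod (p ^ m)) * (k.factorial : ZMod (p ^ m)) = 1 := by
  unfold ifac
  split_ifs with h
  · interval_cases k <;> simp
  · have : NeZero (p ^ m) := ⟨pow_ne_zero _ hp.ne_zero⟩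
    rw [ZMod.natCast_zmod_val, mul_comm]
    apply ZMod.coe_mul_inv_eq_one
    apply Nat.Coprime.pow_right
    exact (hp.coprime_factorial_of_lt hk).symm

/-- Truncated exponential. -/
noncomputable def tE {R : Type*} [Ring R] (p m : ℕ) (x : R) : R :=
  ∑ k ∈ Finset.range p, ifac p m k • x ^ k

namespace Filt

variable {R : Type*} [Ring R] {p m : ℕ} (Φ : Filt R p m)

lemma congr {x : R} (hx : x ∈ Φ.F 1) {a b : ℕ} (h : (a : ZMod (p ^ m)) = b) :
    a • x = b • x := by
  have h1 : ((a : ℤ) : ZMod (p ^ m)) = ((b : ℤ) : ZMod (p ^ m)) := by push_cast; exact h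
  rw [ZMod.intCast_eq_intCast_iff_dvd_sub] at h1
  obtain ⟨q, hq⟩ := h1
  have h2 : ((b : ℤ) - a) • x = 0 := by
    rw [hq, mul_comm, mul_smul]
    have : ((p ^ m : ℕ) : ℤ) • x = 0 := by rw [natCast_zsmul]; exact Φ.tors x hx
    rw [this, smul_zero]
  rw [sub_smul, sub_eq_zero, natCast_zsmul, natCast_zsmul] at h2
  exact h2.symm

lemma pow_mem {x : R} {i : ℕ} (hx : x ∈ Φ.F i) (k : ℕ) : x ^ k ∈ Φ.F (i * k) := by
  induction k with
  | zero => simpa using Φ.one_mem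
  | succ k ih => rw [pow_succ, Nat.mul_succ]; exact Φ.mul_mem ih hx

lemma pow_mem1 {x : R} (hx : x ∈ Φ.F 1) (k : ℕ) : x ^ k ∈ Φ.F k := by
  simpa using Φ.pow_mem hx k

lemma eq_zero {x : R} {j : ℕ} (hj : p ≤ j) (hx : x ∈ Φ.F j) : x = 0 := by
  have := Φ.anti hj hx
  rw [Φ.top] at this
  simpa using this

lemma mul_one_left {x z : R} {j : ℕ} (hx : x ∈ Φ.F 1) (hz : z ∈ Φ.F j) : x * z ∈ Φ.F (j + 1) := by
  rw [add_comm]; exact Φ.mul_mem hx hz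

lemma tE_add (hp : p.Prime) {x y : R} (hx : x ∈ Φ.F 1) (hy : y ∈ Φ.F 1) (h : Commute x y) :
    tE p m x * tE p m y = tE p m (x + y) := by
  unfold tE
  rw [Finset.sum_mul_sum, ← Finset.sum_product']
  have h1 : ∀ k ∈ Finset.range p, ifac p m k • (x + y) ^ k =
      ∑ q ∈ (Finset.range p ×ˢ Finset.range p).filter (fun q => q.1 + q.2 < p) with q.1 + q.2 = k,
        (ifac p m q.1 • x ^ q.1) * (ifac p m q.2 • y ^ q.2) := by
    intro k hk
    rw [Finset.mem_range] at hk
    have h2 : (((Finset.range p ×ˢ Finset.range p).filter (fun q => q.1 + q.2 < p)).filter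
        (fun q => q.1 + q.2 = k)) = Finset.HasAntidiagonal.antidiagonal k := by
      ext q
      simp only [Finset.mem_filter, Finset.mem_product, Finset.mem_range, Finset.HasAntidiagonal.mem_antidiagonal]
      omega
    rw [h2, h.add_pow', Finset.smul_sum]
    apply Finset.sum_congr rfl
    rintro ⟨i, j⟩ hij
    rw [Finset.HasAntidiagonal.mem_antidiagonal] at hij
    simp only at hij ⊢
    rw [smul_mul_smul_comm, smul_smul]
    rcases Nat.eq_zero_or_pos k with h0 | h0
    · have hi : i = 0 := by omega
      have hj : j = 0 := by omega
      subst hi hj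
      subst h0
      simp [ifac]
    · apply Φ.congr
      · apply Φ.anti (show 1 ≤ i + j by omega)
        exact Φ.mul_mem (Φ.pow_mem1 hx i) (Φ.pow_mem1 hy j)
      · have e1 := ifac_spec (m := m) hp hk
        have e2 := ifac_spec (m := m) hp (show i < p by omega)
        have e3 := ifac_spec (m := m) hp (show j < p by omega)
        have e4 : ((k.choose i : ℕ) : ZMod (p ^ m)) * (i.factorial : ZMod (p ^ m))
            * (j.factorial : ZMod (p ^ m)) = (k.factorial : ZMod (p ^ m)) := by
          have := Nat.choose_mul_factorial_mul_factorial (show i ≤ k by omega)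
          rw [show k - i = j by omega] at this
          exact_mod_cast congrArg (Nat.cast : ℕ → ZMod (p ^ m)) this
        push_cast
        generalize (ifac p m k : ZMod (p ^ m)) = a at *
        generalize (ifac p m i : ZMod (p ^ m)) = b at *
        generalize (ifac p m j : ZMod (p ^ m)) = c at *
        generalize (k.factorial : ZMod (p ^ m)) = a' at *
        generalize (i.factorial : ZMod (p ^ m)) = b' at *
        generalize (j.factorial : ZMod (p ^ m)) = c' at *
        generalize (k.choose i : ZMod (p ^ m)) = d at *
        calc a * d = a * d * (b * b') * (c * c') := by rw [e2, e3]; ring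
          _ = a * (d * b' * c') * (b * c) := by ring
          _ = b * c := by rw [e4, e1]; ring
  rw [Finset.sum_congr rfl h1, Finset.sum_fiberwise_of_maps_to]
  · rw [Finset.sum_filter]
    apply Finset.sum_congr rfl
    rintro ⟨i, j⟩ -
    split_ifs with h3
    · rfl
    · simp only at h3 ⊢
      rw [smul_mul_smul_comm, Φ.eq_zero (not_lt.mp h3) (Φ.mul_mem (Φ.pow_mem1 hx i) (Φ.pow_mem1 hy j)),
        smul_zero]
  · intro q hq
    simp only [Finset.mem_filter, Finset.mem_range] at hq ⊢
    exact hq.2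

lemma tE_zero (hp : p.Prime) : tE p m (0 : R) = 1 := by
  unfold tE
  rw [Finset.sum_eq_single 0]
  · simp [ifac]
  · intro k _ hk; simp [hk]
  · intro h; exact absurd (Finset.mem_range.mpr hp.pos) h

lemma tE_pow (hp : p.Prime) {x : R} (hx : x ∈ Φ.F 1) (N : ℕ) :
    tE p m x ^ N = tE p m (N • x) := by
  induction N with
  | zero => simp [tE_zero hp]
  | succ N ih =>
    rw [pow_succ, ih, Φ.tE_add hp (AddSubgroup.nsmul_mem _ hx N) hx, succ_nsmul]
    exact (Commute.refl x).smul_left N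

lemma tE_map {S : Type*} [Ring S] (φ : R →+* S) (x : R) : φ (tE p m x) = tE p m (φ x) := by
  unfold tE
  simp [map_sum, map_pow]

lemma pow_sub_pow {x y : R} {j : ℕ} (hx : x ∈ Φ.F 1) (hy : y ∈ Φ.F 1) (h : x - y ∈ Φ.F j) (k : ℕ) :
    x ^ (k + 1) - y ^ (k + 1) ∈ Φ.F (j + k) := by
  induction k with
  | zero => simpa using h
  | succ k ih =>
    have : x ^ (k + 1 + 1) - y ^ (k + 1 + 1) =
        x * (x ^ (k + 1) - y ^ (k + 1)) + (x - y) * y ^ (k + 1) := by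
      rw [pow_succ' x (k + 1), pow_succ' y (k + 1)]; noncomm_ring
    rw [this]
    exact add_mem (Φ.mul_one_left hx ih) (Φ.mul_mem h (Φ.pow_mem1 hy _))

lemma tE_sub (hp : p.Prime) {x y : R} {j : ℕ} (hx : x ∈ Φ.F 1) (hy : y ∈ Φ.F 1)
    (h : x - y ∈ Φ.F j) : tE p m x - tE p m y - (x - y) ∈ Φ.F (j + 1) := by
  obtain ⟨q, rfl⟩ : ∃ q, p = q + 2 := ⟨p - 2, by have := hp.two_le; omega⟩
  have : tE (q + 2) m x - tE (q + 2) m y - (x - y) =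
      ∑ k ∈ Finset.range q, ifac (q + 2) m (k + 2) • (x ^ (k + 2) - y ^ (k + 2)) := by
    unfold tE
    rw [Finset.sum_range_succ', Finset.sum_range_succ', Finset.sum_range_succ',
      Finset.sum_range_succ']
    simp only [smul_sub, Finset.sum_sub_distrib]
    simp [ifac]
    abel
  rw [this]
  refine sum_mem fun k _ => AddSubgroup.nsmul_mem _ ?_ _
  exact Φ.anti (by omega) (Φ.pow_sub_pow hx hy h (k + 1))

lemma tE_one (hp : p.Prime) {a : R} {k : ℕ} (hk : 1 ≤ k) (ha : a ∈ Φ.F k) :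
    tE p m a - 1 - a ∈ Φ.F (k + 1) := by
  have := Φ.tE_sub hp (Φ.anti hk ha) (zero_mem _) (j := k) (by simpa using ha)
  rwa [tE_zero hp, sub_zero] at this

lemma tE_mem (hp : p.Prime) {a : R} (ha : a ∈ Φ.F 1) : tE p m a - 1 ∈ Φ.F 1 := by
  have := add_mem (Φ.anti (by omega) (Φ.tE_one hp le_rfl ha)) ha
  simpa using this

lemma tE_exists (hp : p.Prime) {g : R} (hg : g - 1 ∈ Φ.F 1) : ∃ x ∈ Φ.F 1, tE p m x = g := by
  have : ∀ j : ℕ, ∃ x ∈ Φ.F 1, tE p m x - g ∈ Φ.F (j + 1) := by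
    intro j
    induction j with
    | zero =>
      refine ⟨0, zero_mem _, ?_⟩
      rw [tE_zero hp, ← neg_sub]; exact neg_mem hg
    | succ j ih =>
      obtain ⟨x, hx, h⟩ := ih
      have h' : g - tE p m x ∈ Φ.F (j + 1) := by rw [← neg_sub]; exact neg_mem h
      have hx' : x + (g - tE p m x) ∈ Φ.F 1 := add_mem hx (Φ.anti (by omega) h')
      refine ⟨_, hx', ?_⟩
      have := Φ.tE_sub hp hx' hx (j := j + 1) (by simpa using h')
      convert this using 1
      abel
  obtain ⟨x, hx, h⟩ := this p
  exact ⟨x, hx, sub_eq_zero.mp (Φ.eq_zero (by omega) h)⟩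

lemma tE_inj (hp : p.Prime) {x y : R} (hx : x ∈ Φ.F 1) (hy : y ∈ Φ.F 1)
    (h : tE p m x = tE p m y) : x = y := by
  have : ∀ j : ℕ, x - y ∈ Φ.F (j + 1) := by
    intro j
    induction j with
    | zero => exact sub_mem hx hy
    | succ j ih =>
      have := Φ.tE_sub hp hx hy ih
      rw [h, sub_self, zero_sub] at this
      exact neg_mem_iff.mp this
  exact sub_eq_zero.mp (Φ.eq_zero (by omega) (this p))

lemma mul_congr {j : ℕ} {f f' g g' z w : R} (hf : f - f' - z ∈ Φ.F (j + 1))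
    (hg : g - g' - w ∈ Φ.F (j + 1)) (hz : z ∈ Φ.F j) (hw : w ∈ Φ.F j)
    (hf' : f' - 1 ∈ Φ.F 1) (hg1 : g - 1 ∈ Φ.F 1) :
    f * g - f' * g' - (z + w) ∈ Φ.F (j + 1) := by
  have e : f * g - f' * g' - (z + w) = (f - f' - z) * (g - 1) + (f - f' - z) + (f' - 1) * (g - g' - w)
      + (g - g' - w) + z * (g - 1) + (f' - 1) * w := by noncomm_ring
  rw [e]
  refine add_mem (add_mem (add_mem (add_mem (add_mem ?_ hf) ?_) hg) ?_) ?_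
  · exact Φ.anti (by omega) (Φ.mul_mem hf hg1)
  · exact Φ.anti (by omega) (Φ.mul_mem hf' hg)
  · exact Φ.mul_mem hz hg1
  · exact Φ.mul_one_left hf' hw

lemma mul_one_mem {f g : R} (hf : f - 1 ∈ Φ.F 1) (hg : g - 1 ∈ Φ.F 1) : f * g - 1 ∈ Φ.F 1 := by
  have e : f * g - 1 = (f - 1) * (g - 1) + (f - 1) + (g - 1) := by noncomm_ring
  rw [e]
  exact add_mem (add_mem (Φ.anti (by omega) (Φ.mul_mem hf hg)) hf) hg

lemma pow_congr {j : ℕ} {f f' z : R} (hf : f - f' - z ∈ Φ.F (j + 1)) (hz : z ∈ Φ.F j)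
    (hf' : f' - 1 ∈ Φ.F 1) (hf1 : f - 1 ∈ Φ.F 1) (N : ℕ) :
    f ^ N - f' ^ N - N • z ∈ Φ.F (j + 1) ∧ f' ^ N - 1 ∈ Φ.F 1 ∧ f ^ N - 1 ∈ Φ.F 1 := by
  induction N with
  | zero => simp
  | succ N ih =>
    obtain ⟨h1, h2, h3⟩ := ih
    rw [pow_succ, pow_succ, succ_nsmul]
    exact ⟨Φ.mul_congr h1 hf (AddSubgroup.nsmul_mem _ hz N) hz h2 hf1, Φ.mul_one_mem h2 hf',
      Φ.mul_one_mem h3 hf1⟩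

/-- Key extraction of homogeneous leading terms. -/
lemma key (hp : p.Prime) (σ : R →+* R) (c : ℕ)
    (hσ : ∀ j x, x ∈ Φ.F j → σ x ∈ Φ.F j)
    (hdec : ∀ j w, w ∈ Φ.F j → ∃ z ∈ Φ.F j, w - z ∈ Φ.F (j + 1) ∧ σ z = c ^ j • z)
    (hc : ∀ k j, k < j → j < p → 1 ≤ k →
      ∃ v : ℕ, (v : ZMod (p ^ m)) * ((c : ZMod (p ^ m)) ^ j - (c : ZMod (p ^ m)) ^ k) = 1)
    (Γ : Submonoid R) (hΓ : ∀ f ∈ Γ, f - 1 ∈ Φ.F 1) (hΓσ : ∀ f ∈ Γ, σ f ∈ Γ) :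
    ∀ d k : ℕ, p ≤ k + d → 1 ≤ k → ∀ f ∈ Γ, ∀ a ∈ Φ.F k, σ a = c ^ k • a →
      f - 1 - a ∈ Φ.F (k + 1) → tE p m a ∈ Γ := by
  have : NeZero (p ^ m) := ⟨pow_ne_zero _ hp.ne_zero⟩
  intro d
  induction d with
  | zero =>
    intro k hk _ f _ a ha _ _
    rw [Φ.eq_zero hk ha, tE_zero hp]
    exact Γ.one_mem
  | succ d ihd =>
    intro k hk hk1 f hf a ha hσa hfa
    have ha1 : a ∈ Φ.F 1 := Φ.anti hk1 ha
    have hEa := Φ.tE_mem hp ha1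
    suffices H : ∀ i : ℕ, ∃ f ∈ Γ, f - tE p m a ∈ Φ.F (k + 1 + i) by
      obtain ⟨f, hf, h⟩ := H p
      rw [← sub_eq_zero.mp (Φ.eq_zero (by omega) h)]
      exact hf
    intro i
    induction i with
    | zero =>
      refine ⟨f, hf, ?_⟩
      have := sub_mem hfa (Φ.tE_one hp hk1 ha)
      convert this using 1
      abel
    | succ i ihi =>
      obtain ⟨f, hf, h⟩ := ihi
      rcases le_or_gt p (k + 1 + i) with hpi | hpi
      · refine ⟨f, hf, ?_⟩
        rw [Φ.eq_zero hpi h]; exact zero_mem _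
      generalize hj : k + 1 + i = j at *
      rw [show k + 1 + (i + 1) = j + 1 by omega]
      obtain ⟨z, hz, hzw, hσz⟩ := hdec j _ h
      have hz1 : z ∈ Φ.F 1 := Φ.anti (by omega) hz
      obtain ⟨v, hv⟩ := hc k j (by omega) hpi hk1
      -- powers
      obtain ⟨N, hN⟩ : ∃ N : ℕ, (N : ZMod (p ^ m)) = - (c : ZMod (p ^ m)) ^ k :=
        ⟨(- (c : ZMod (p ^ m)) ^ k).val, ZMod.natCast_zmod_val _⟩
      obtain ⟨V, hV⟩ : ∃ N : ℕ, (N : ZMod (p ^ m)) = - (v : ZMod (p ^ m)) :=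
        ⟨(- (v : ZMod (p ^ m))).val, ZMod.natCast_zmod_val _⟩
      obtain ⟨h1, h2, h3⟩ := Φ.pow_congr hzw hz hEa (hΓ f hf) N
      have h4 : σ f - tE p m (c ^ k • a) - c ^ j • z ∈ Φ.F (j + 1) := by
        have := hσ _ _ hzw
        rwa [map_sub, map_sub, tE_map, hσa, hσz] at this
      have hca : c ^ k • a ∈ Φ.F 1 := AddSubgroup.nsmul_mem _ ha1 _
      have h5 := Φ.mul_congr h4 h1 (AddSubgroup.nsmul_mem _ hz _) (AddSubgroup.nsmul_mem _ hz _)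
        (Φ.tE_mem hp hca) h3
      have h6 : tE p m (c ^ k • a) * tE p m a ^ N = 1 := by
        rw [← Φ.tE_pow hp ha1, ← pow_add, Φ.tE_pow hp ha1, ← tE_zero (R := R) (m := m) hp]
        congr 1
        rw [← zero_smul ℕ a]
        apply Φ.congr ha1
        push_cast
        rw [hN]; ring
      rw [h6, ← add_smul] at h5
      have h7 := ihd j (by omega) (by omega) _ (Γ.mul_mem (hΓσ f hf) (Γ.pow_mem hf N)) _
        (AddSubgroup.nsmul_mem _ hz (c ^ j + N)) (by
          rw [map_nsmul, hσz, smul_comm]) h5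
      have h8 := Γ.pow_mem h7 V
      rw [Φ.tE_pow hp (AddSubgroup.nsmul_mem _ hz1 _), smul_smul] at h8
      have h9 : (V * (c ^ j + N)) • z = -z := by
        have : (V * (c ^ j + N) + 1) • z = 0 • z := by
          apply Φ.congr hz1
          push_cast
          rw [hV, hN]
          linear_combination - hv
        rw [add_smul, one_smul, zero_smul] at this
        exact eq_neg_of_add_eq_zero_left this
      rw [h9] at h8
      refine ⟨_, Γ.mul_mem hf h8, ?_⟩
      have h10 := Φ.mul_congr (f' := tE p m a) (g' := 1) (z := z) (w := -z) hzw
        (Φ.tE_one hp (by omega) (neg_mem hz)) hz (neg_mem hz) hEa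
        (Φ.tE_mem hp (neg_mem hz1))
      simpa using h10

end Filt

section PolyPart

open Polynomial

variable {R : Type*} [Ring R] {p m : ℕ}

/-- Evaluation at a natural number. -/
noncomputable def evN (R : Type*) [Ring R] (t : ℕ) : R[X] →+* R :=
  eval₂RingHom' (RingHom.id R) (t : R) (fun a => Nat.commute_cast a t)

/-- Scaling of the variable. -/
noncomputable def scN (R : Type*) [Ring R] (c : ℕ) : R[X] →+* R[X] :=
  eval₂RingHom' C ((c : R[X]) * X)
    (fun a => (Nat.commute_cast (C a) c).mul_right (X_mul (p := C a)).symm)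

lemma evN_monomial (t k : ℕ) (a : R) : evN R t (monomial k a) = t ^ k • a := by
  have : evN R t (monomial k a) = a * (t : R) ^ k := by
    simp [evN, eval₂RingHom', eval₂_monomial]
  rw [this, nsmul_eq_mul]
  push_cast
  rw [← Nat.cast_pow]
  exact (Nat.cast_commute _ _).symm

lemma scN_monomial (t k : ℕ) (a : R) : scN R t (monomial k a) = t ^ k • monomial k a := by
  have : scN R t (monomial k a) = C a * ((t : R[X]) * X) ^ k := by
    simp [scN, eval₂RingHom', eval₂_monomial]
  rw [this, (Nat.cast_commute t (X : R[X])).mul_pow, nsmul_eq_mul, ← C_mul_X_pow_eq_monomial,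
    ← mul_assoc, ← mul_assoc]
  push_cast
  rw [← Nat.cast_pow]
  rw [(Nat.cast_commute (t ^ k) (C a)).eq]

lemma scN_coeff (c : ℕ) (f : R[X]) (i : ℕ) : (scN R c f).coeff i = c ^ i • f.coeff i := by
  induction f using Polynomial.induction_on' with
  | add f g hf hg => rw [map_add, coeff_add, hf, hg, coeff_add, smul_add]
  | monomial k a =>
    rw [scN_monomial, coeff_smul, coeff_monomial]
    split_ifs with h
    · rw [h]
    · simp

lemma evN_scN (t c : ℕ) (f : R[X]) : evN R t (scN R c f) = evN R (c * t) f := by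
  induction f using Polynomial.induction_on' with
  | add f g hf hg => rw [map_add, map_add, map_add, hf, hg]
  | monomial k a =>
    rw [scN_monomial, map_nsmul, evN_monomial, evN_monomial, smul_smul, mul_pow]

/-- The induced filtration on polynomials. -/
noncomputable def Filt.poly (Φ : Filt R p m) : Filt R[X] p m where
  F j :=
    { carrier := {f | (∀ i, f.coeff i ∈ Φ.F i) ∧ ∀ i < j, f.coeff i = 0}
      zero_mem' := by simp [zero_mem]
      add_mem' := by
        rintro f g ⟨h1, h2⟩ ⟨h3, h4⟩
        refine ⟨fun i => ?_, fun i hi => ?_⟩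
        · rw [coeff_add]; exact add_mem (h1 i) (h3 i)
        · rw [coeff_add, h2 i hi, h4 i hi, add_zero]
      neg_mem' := by
        rintro f ⟨h1, h2⟩
        refine ⟨fun i => ?_, fun i hi => ?_⟩
        · rw [coeff_neg]; exact neg_mem (h1 i)
        · rw [coeff_neg, h2 i hi, neg_zero] }
  one_mem := by
    refine ⟨fun i => ?_, fun i hi => absurd hi (by omega)⟩
    rw [coeff_one]
    split_ifs with h
    · subst h; exact Φ.one_mem
    · exact zero_mem _
  mul_mem := by
    rintro i j f g ⟨h1, h2⟩ ⟨h3, h4⟩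
    refine ⟨fun k => ?_, fun k hk => ?_⟩
    · rw [coeff_mul]
      refine sum_mem fun q hq => ?_
      rw [Finset.HasAntidiagonal.mem_antidiagonal] at hq
      rw [← hq]
      exact Φ.mul_mem (h1 _) (h3 _)
    · rw [coeff_mul]
      refine Finset.sum_eq_zero fun q hq => ?_
      rw [Finset.HasAntidiagonal.mem_antidiagonal] at hq
      rcases lt_or_ge q.1 i with h | h
      · rw [h2 _ h, zero_mul]
      · rw [h4 _ (by omega), mul_zero]
  anti := by
    rintro i j hij f ⟨h1, h2⟩
    exact ⟨h1, fun k hk => h2 k (by omega)⟩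
  top := by
    rw [eq_bot_iff]
    rintro f ⟨h1, h2⟩
    rw [AddSubgroup.mem_bot]
    ext i
    rw [coeff_zero]
    rcases lt_or_ge i p with h | h
    · exact h2 i h
    · exact Φ.eq_zero h (h1 i)
  tors := by
    rintro f ⟨h1, h2⟩
    ext i
    rw [coeff_smul, coeff_zero]
    rcases Nat.eq_zero_or_pos i with h | h
    · rw [h2 i (by omega), smul_zero]
    · exact Φ.tors _ (Φ.anti h (h1 i))

lemma Filt.mem_poly (Φ : Filt R p m) (j : ℕ) (f : R[X]) :
    f ∈ Φ.poly.F j ↔ (∀ i, f.coeff i ∈ Φ.F i) ∧ ∀ i < j, f.coeff i = 0 := Iff.rfl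

lemma Filt.monomial_mem (Φ : Filt R p m) {j : ℕ} {a : R} (ha : a ∈ Φ.F j) :
    monomial j a ∈ Φ.poly.F j := by
  rw [Filt.mem_poly]
  refine ⟨fun i => ?_, fun i hi => ?_⟩
  · rw [coeff_monomial]
    split_ifs with h
    · exact h ▸ ha
    · exact zero_mem _
  · rw [coeff_monomial, if_neg (by omega)]

lemma exists_root (m : ℕ) (hp : p.Prime) : ∃ c : ℕ, ∀ k j, k < j → j < p → 1 ≤ k →
    ∃ v : ℕ, (v : ZMod (p ^ m)) * ((c : ZMod (p ^ m)) ^ j - (c : ZMod (p ^ m)) ^ k) = 1 := by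
  have : Fact p.Prime := ⟨hp⟩
  have : NeZero (p ^ m) := ⟨pow_ne_zero _ hp.ne_zero⟩
  obtain ⟨g, hg⟩ := IsCyclic.exists_generator (α := (ZMod p)ˣ)
  have ho : orderOf g = p - 1 := by
    rw [orderOf_eq_card_of_forall_mem_zpowers hg, Nat.card_eq_fintype_card, ZMod.card_units]
  refine ⟨(g : ZMod p).val, fun k j hkj hj hk => ?_⟩
  set c := (g : ZMod p).val with hc
  have hcg : (c : ZMod p) = g := ZMod.natCast_zmod_val _
  have hne : (((c : ℤ) ^ j - (c : ℤ) ^ k : ℤ) : ZMod p) ≠ 0 := by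
    push_cast
    rw [hcg]
    intro h
    rw [sub_eq_zero] at h
    have h' : g ^ j = g ^ k := by
      ext; push_cast; exact h
    rw [pow_inj_mod, ho, Nat.mod_eq_of_lt (by omega : k < p - 1)] at h'
    rcases Nat.lt_or_ge j (p - 1) with h1 | h1
    · rw [Nat.mod_eq_of_lt h1] at h'; omega
    · rw [show j = p - 1 by omega, Nat.mod_self] at h'; omega
  have hcop : IsCoprime ((c : ℤ) ^ j - (c : ℤ) ^ k) ((p : ℤ) ^ m) := by
    apply IsCoprime.pow_right
    rw [isCoprime_comm, (Nat.prime_iff_prime_int.mp hp).coprime_iff_not_dvd]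
    rwa [Ne, ZMod.intCast_zmod_eq_zero_iff_dvd] at hne
  obtain ⟨a, b, hab⟩ := hcop
  refine ⟨((a : ZMod (p ^ m))).val, ?_⟩
  rw [ZMod.natCast_zmod_val]
  have := congrArg (Int.cast : ℤ → ZMod (p ^ m)) hab
  push_cast at this
  have hz : (p : ZMod (p ^ m)) ^ m = 0 := by
    have := ZMod.natCast_self (p ^ m)
    push_cast at this
    exact this
  rw [hz, mul_zero, add_zero] at this
  exact this

lemma Filt.extract (Φ : Filt R p m) (hp : p.Prime) (G : Submonoid R)
    (f : R[X]) (hf1 : f - 1 ∈ Φ.poly.F 1) (hfG : ∀ t : ℕ, evN R t f ∈ G) (k : ℕ) (hk : 1 ≤ k)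
    (a : R) (ha : a ∈ Φ.F k) (h : f - 1 - monomial k a ∈ Φ.poly.F (k + 1)) : tE p m a ∈ G := by
  obtain ⟨c, hc⟩ := exists_root m hp
  have hσ : ∀ j x, x ∈ Φ.poly.F j → scN R c x ∈ Φ.poly.F j := by
    rintro j x ⟨h1, h2⟩
    refine ⟨fun i => ?_, fun i hi => ?_⟩
    · rw [scN_coeff]; exact AddSubgroup.nsmul_mem _ (h1 i) _
    · rw [scN_coeff, h2 i hi, smul_zero]
  have key := Φ.poly.key hp (scN R c) c hσ
    (by
      rintro j w ⟨h1, h2⟩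
      refine ⟨monomial j (w.coeff j), Φ.monomial_mem (h1 j), ?_, scN_monomial _ _ _⟩
      refine ⟨fun i => ?_, fun i hi => ?_⟩
      · rw [coeff_sub]
        exact sub_mem (h1 i) ((Φ.monomial_mem (h1 j)).1 i)
      · rw [coeff_sub, coeff_monomial]
        split_ifs with hij
        · rw [hij, sub_self]
        · rw [h2 i (by omega), sub_zero]) hc
    { carrier := {f | f - 1 ∈ Φ.poly.F 1 ∧ ∀ t : ℕ, evN R t f ∈ G}
      one_mem' := by
        refine ⟨by simp [zero_mem], fun t => ?_⟩
        rw [map_one]; exact G.one_mem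
      mul_mem' := by
        rintro f g ⟨h1, h2⟩ ⟨h3, h4⟩
        refine ⟨Φ.poly.mul_one_mem h1 h3, fun t => ?_⟩
        rw [map_mul]; exact G.mul_mem (h2 t) (h4 t) }
    (fun f hf => hf.1)
    (fun f hf => ⟨by
      have := hσ _ _ hf.1
      rwa [map_sub, map_one] at this, fun t => by
        rw [evN_scN]; exact hf.2 _⟩)
    p k (by omega) hk f ⟨hf1, hfG⟩ (monomial k a) (Φ.monomial_mem ha) (scN_monomial _ _ _) h
  have := key.2 1
  rwa [Filt.tE_map, evN_monomial, one_pow, one_smul] at this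

lemma Filt.lin_mem (Φ : Filt R p m) (hp : p.Prime) (G : Submonoid R) {x : R} (hx : x ∈ Φ.F 1)
    (hxG : tE p m x ∈ G) (t : ℕ) : evN R t (tE p m (monomial 1 x)) ∈ G := by
  rw [Filt.tE_map, evN_monomial, pow_one, ← Φ.tE_pow hp hx]
  exact G.pow_mem hxG t

lemma Filt.neg_closed (Φ : Filt R p m) (hp : p.Prime) (G : Submonoid R) {x : R} (hx : x ∈ Φ.F 1)
    (hxG : tE p m x ∈ G) : tE p m (-x) ∈ G := by
  have h := G.pow_mem hxG (p ^ m - 1)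
  rw [Φ.tE_pow hp hx] at h
  have h1 : (p ^ m - 1 + 1) • x = 0 := by
    rw [Nat.sub_add_cancel (Nat.one_le_pow _ _ hp.pos)]
    exact Φ.tors x hx
  rw [succ_nsmul] at h1
  rwa [eq_neg_of_add_eq_zero_left h1] at h

lemma Filt.add_closed (Φ : Filt R p m) (hp : p.Prime) (G : Submonoid R) {x y : R}
    (hx : x ∈ Φ.F 1) (hy : y ∈ Φ.F 1) (hxG : tE p m x ∈ G) (hyG : tE p m y ∈ G) :
    tE p m (x + y) ∈ G := by
  have mx := Φ.monomial_mem hx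
  have my := Φ.monomial_mem hy
  have ex := Φ.poly.tE_mem hp mx
  have ey := Φ.poly.tE_mem hp my
  refine Φ.extract hp G (tE p m (monomial 1 x) * tE p m (monomial 1 y))
    (Φ.poly.mul_one_mem ex ey) (fun t => ?_) 1 le_rfl _ (add_mem hx hy) ?_
  · rw [map_mul]
    exact G.mul_mem (Φ.lin_mem hp G hx hxG t) (Φ.lin_mem hp G hy hyG t)
  · rw [map_add]
    have := Φ.poly.mul_congr (Φ.poly.tE_one hp le_rfl mx) (Φ.poly.tE_one hp le_rfl my) mx my
      (by simp [zero_mem]) ey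
    simpa using this

lemma Filt.bracket_closed (Φ : Filt R p m) (hp : p.Prime) (G : Submonoid R) {x y : R}
    (hx : x ∈ Φ.F 1) (hy : y ∈ Φ.F 1) (hxG : tE p m x ∈ G) (hyG : tE p m y ∈ G) :
    tE p m (x * y - y * x) ∈ G := by
  have mx := Φ.monomial_mem hx
  have my := Φ.monomial_mem hy
  have ex := Φ.poly.tE_mem hp mx
  have ey := Φ.poly.tE_mem hp my
  have ex' := Φ.poly.tE_mem hp (neg_mem mx)
  have ey' := Φ.poly.tE_mem hp (neg_mem my)
  have hb : x * y - y * x ∈ Φ.F 2 := sub_mem (Φ.mul_mem hx hy) (Φ.mul_mem hy hx)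
  have e1 : ∀ z : R, z ∈ Φ.F 1 → tE p m (monomial 1 z) * tE p m (-(monomial 1 z)) = 1 := by
    intro z hz
    have mz := Φ.monomial_mem hz
    rw [Φ.poly.tE_add hp mz (neg_mem mz) (Commute.refl _).neg_right, add_neg_cancel,
      Filt.tE_zero hp]
  -- rename
  generalize hU : tE p m (monomial 1 x) = U at *
  generalize hV : tE p m (monomial 1 y) = V at *
  generalize hU' : tE p m (-(monomial 1 x)) = U' at *
  generalize hV' : tE p m (-(monomial 1 y)) = V' at *
  have eU : U * U' = 1 := by rw [← hU, ← hU']; exact e1 x hx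
  have eV : V * V' = 1 := by rw [← hV, ← hV']; exact e1 y hy
  have sU : U - 1 - monomial 1 x ∈ Φ.poly.F 2 := by
    rw [← hU]; exact Φ.poly.tE_one hp le_rfl mx
  have sV : V - 1 - monomial 1 y ∈ Φ.poly.F 2 := by
    rw [← hV]; exact Φ.poly.tE_one hp le_rfl my
  refine Φ.extract hp G (U * V * (U' * V'))
    (Φ.poly.mul_one_mem (Φ.poly.mul_one_mem ex ey) (Φ.poly.mul_one_mem ex' ey'))
    (fun t => ?_) 2 (by omega) _ hb ?_
  · rw [map_mul, map_mul, map_mul]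
    refine G.mul_mem (G.mul_mem ?_ ?_) (G.mul_mem ?_ ?_)
    · rw [← hU]; exact Φ.lin_mem hp G hx hxG t
    · rw [← hV]; exact Φ.lin_mem hp G hy hyG t
    · rw [← hU', ← map_neg]
      exact Φ.lin_mem hp G (neg_mem hx) (Φ.neg_closed hp G hx hxG) t
    · rw [← hV', ← map_neg]
      exact Φ.lin_mem hp G (neg_mem hy) (Φ.neg_closed hp G hy hyG) t
  · have c1 : U * V * (U' * V') - 1 = (U * V - V * U) * (U' * V') := by
      have : V * U * (U' * V') = 1 := by
        calc V * U * (U' * V') = V * (U * U') * V' := by noncomm_ring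
          _ = 1 := by rw [eU, mul_one, eV]
      rw [sub_mul, this]
    have c2 : monomial 2 (x * y - y * x) =
        (monomial 1 x : R[X]) * monomial 1 y - monomial 1 y * monomial 1 x := by
      rw [monomial_mul_monomial, monomial_mul_monomial, map_sub]
    rw [c1, c2]
    generalize (monomial 1 x : R[X]) = X1 at *
    generalize (monomial 1 y : R[X]) = Y1 at *
    have s1 : U * V - V * U - (X1 * Y1 - Y1 * X1) ∈ Φ.poly.F 3 := by
      have : U * V - V * U - (X1 * Y1 - Y1 * X1) =
          (U - 1 - X1) * (V - 1) + X1 * (V - 1 - Y1) - ((V - 1 - Y1) * (U - 1)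
            + Y1 * (U - 1 - X1)) := by noncomm_ring
      rw [this]
      exact sub_mem (add_mem (Φ.poly.mul_mem sU ey) (Φ.poly.mul_mem mx sV))
        (add_mem (Φ.poly.mul_mem sV ex) (Φ.poly.mul_mem my sU))
    have s2 : U * V - V * U ∈ Φ.poly.F 2 := by
      have : U * V - V * U = (U - 1) * (V - 1) - (V - 1) * (U - 1) := by noncomm_ring
      rw [this]
      exact sub_mem (Φ.poly.mul_mem ex ey) (Φ.poly.mul_mem ey ex)
    have s3 := Φ.poly.mul_mem s2 (Φ.poly.mul_one_mem ex' ey')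
    have := add_mem s3 s1
    convert this using 1
    noncomm_ring

end PolyPart

namespace LeftBrace

variable {A : Type u} [AddCommGroup A] (B : LeftBrace A)

lemma circ_zero (a : A) : B.circ a 0 = a := by
  have := B.circ_add a 0 0
  rw [add_zero] at this
  exact (add_left_cancel this).symm

lemma one_eq : B.one = 0 := by
  rw [← B.circ_zero B.one, B.one_circ]

/-- `λ_a(b) = a ∘ b - a`. -/
def lam (a : A) : A →+ A where
  toFun b := B.circ a b - a
  map_zero' := by rw [circ_zero, sub_self]
  map_add' b c := by
    have := B.circ_add a b c
    rw [eq_sub_of_add_eq this]; abel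

lemma lam_apply (a b : A) : B.lam a b = B.circ a b - a := rfl

lemma circ_eq (a b : A) : B.circ a b = a + B.lam a b := by rw [lam_apply]; abel

lemma lam_circ (a b c : A) : B.lam (B.circ a b) c = B.lam a (B.lam b c) := by
  have h1 : B.circ (B.circ a b) c = B.circ a (B.circ b c) := B.circ_assoc a b c
  have h2 : B.lam a (B.circ b c) = B.lam a b + B.lam a (B.lam b c) := by
    rw [B.circ_eq b c, map_add]
  rw [lam_apply, h1, B.circ_eq a (B.circ b c), h2, B.circ_eq a b]; abel

lemma lam_zero (c : A) : B.lam 0 c = c := by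
  rw [lam_apply, ← B.one_eq, B.one_circ, B.one_eq, sub_zero]

/-- Type synonym carrying the multiplicative group. -/
structure Mg {A : Type u} [AddCommGroup A] (B : LeftBrace A) where
  val : A

instance : Group (Mg B) where
  mul x y := ⟨B.circ x.val y.val⟩
  one := ⟨B.one⟩
  inv x := ⟨B.inv x.val⟩
  mul_assoc x y z := congrArg Mg.mk (B.circ_assoc _ _ _)
  one_mul x := congrArg Mg.mk (B.one_circ _)
  mul_one x := congrArg Mg.mk (B.circ_one _)
  inv_mul_cancel x := congrArg Mg.mk (B.inv_circ _)

lemma Mg.mul_val (x y : Mg B) : (x * y).val = B.circ x.val y.val := rfl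
lemma Mg.one_val : (1 : Mg B).val = 0 := B.one_eq

/-- `Mg B` is `A` as a set. -/
def mgEquiv : Mg B ≃ A := ⟨Mg.val, Mg.mk, fun _ => rfl, fun _ => rfl⟩

/-- Next step of the upper chain. -/
def nxt (M : AddSubgroup A) : AddSubgroup A where
  carrier := {b | ∀ a, B.lam a b - b ∈ M}
  zero_mem' := by intro a; simp [zero_mem]
  add_mem' := by
    intro b c hb hc a
    have := add_mem (hb a) (hc a)
    rw [map_add]
    convert this using 1
    abel
  neg_mem' := by
    intro b hb a
    have := neg_mem (hb a)
    rw [map_neg]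
    convert this using 1
    abel

/-- Upper chain. -/
def upc : ℕ → AddSubgroup A
  | 0 => ⊥
  | i + 1 => B.nxt (upc i)

lemma upc_mono (i : ℕ) : B.upc i ≤ B.upc (i + 1) := by
  induction i with
  | zero => exact bot_le
  | succ i ih => intro b hb a; exact ih (hb a)

lemma upc_stable (i : ℕ) {b : A} (hb : b ∈ B.upc i) (a : A) : B.lam a b ∈ B.upc i := by
  have := B.upc_mono i hb a
  have := add_mem this hb
  simpa using this

lemma exists_new {p n : ℕ} (hp : p.Prime) (hcard : Nat.card A = p ^ n) (M : AddSubgroup A)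
    (hM : ∀ b ∈ M, ∀ a, B.lam a b ∈ M) (hne : M ≠ ⊤) :
    ∃ b, b ∉ M ∧ b ∈ B.nxt M := by
  have : Fact p.Prime := ⟨hp⟩
  have hfin : Finite A := Nat.finite_of_card_ne_zero (by rw [hcard]; exact pow_ne_zero _ hp.ne_zero)
  have hG : IsPGroup p (Mg B) := IsPGroup.of_card (n := n) (by rw [Nat.card_congr B.mgEquiv, hcard])
  let act : MulAction (Mg B) (A ⧸ M) :=
    { smul := fun a q => QuotientAddGroup.map M M (B.lam a.val) (fun b hb => hM b hb _) q
      one_smul := by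
        intro q
        induction q using QuotientAddGroup.induction_on with
        | H b =>
          change ((B.lam (1 : Mg B).val b : A) : A ⧸ M) = b
          rw [Mg.one_val, lam_zero]
      mul_smul := by
        intro x y q
        induction q using QuotientAddGroup.induction_on with
        | H b =>
          change ((B.lam (x * y).val b : A) : A ⧸ M) = ((B.lam x.val (B.lam y.val b) : A) : A ⧸ M)
          rw [Mg.mul_val, lam_circ] }
  have hsm : ∀ (a : Mg B) (b : A), a • (b : A ⧸ M) = ((B.lam a.val b : A) : A ⧸ M) :=
    fun a b => rfl
  have hdvd : p ∣ Nat.card (A ⧸ M) := by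
    have h1 : M.index ∣ p ^ n := hcard ▸ M.index_dvd_card
    have h2 : Nat.card (A ⧸ M) = M.index := rfl
    rw [h2]
    obtain ⟨k, _, hk⟩ := (Nat.dvd_prime_pow hp).1 h1
    rw [hk]
    refine dvd_pow_self p ?_
    rintro rfl
    rw [pow_zero, AddSubgroup.index_eq_one] at hk
    exact hne hk
  obtain ⟨q, hq, hq0⟩ := hG.exists_fixed_point_of_prime_dvd_card_of_fixed_point (A ⧸ M) hdvd
    (a := ((0 : A) : A ⧸ M)) (by
      intro a
      rw [hsm, map_zero])
  induction q using QuotientAddGroup.induction_on with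
  | H b =>
    refine ⟨b, fun hb => hq0 ?_, fun a => ?_⟩
    · rw [eq_comm]
      exact (QuotientAddGroup.eq_zero_iff b).2 hb
    · have := hq ⟨a⟩
      rw [hsm, QuotientAddGroup.eq] at this
      have := neg_mem this
      convert this using 1
      simp only [neg_add_rev, neg_neg]
      abel

lemma upc_card {p n : ℕ} (hp : p.Prime) (hcard : Nat.card A = p ^ n) (i : ℕ) :
    B.upc i = ⊤ ∨ p ^ i ≤ Nat.card (B.upc i) := by
  have hfin : Finite A := Nat.finite_of_card_ne_zero (by rw [hcard]; exact pow_ne_zero _ hp.ne_zero)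
  induction i with
  | zero => right; simpa using Nat.one_le_iff_ne_zero.2 Nat.card_pos.ne'
  | succ i ih =>
    by_cases ht : B.upc i = ⊤
    · left
      exact top_le_iff.1 (ht ▸ B.upc_mono i)
    · right
      have h := ih.resolve_left ht
      obtain ⟨b, hb, hb'⟩ := B.exists_new hp hcard (B.upc i)
        (fun b hb a => B.upc_stable i hb a) ht
      have hlt : B.upc i < B.upc (i + 1) :=
        lt_of_le_of_ne (B.upc_mono i) (fun he => hb (he ▸ hb'))
      have hd : Nat.card (B.upc i) ∣ Nat.card (B.upc (i + 1)) :=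
        AddSubgroup.card_dvd_of_le hlt.le
      have h1 : Nat.card (B.upc i) ∣ p ^ n := hcard ▸ AddSubgroup.card_addSubgroup_dvd_card _
      have h2 : Nat.card (B.upc (i + 1)) ∣ p ^ n := hcard ▸ AddSubgroup.card_addSubgroup_dvd_card _
      obtain ⟨k, _, hk⟩ := (Nat.dvd_prime_pow hp).1 h1
      obtain ⟨l, _, hl⟩ := (Nat.dvd_prime_pow hp).1 h2
      have hne : Nat.card (B.upc i) ≠ Nat.card (B.upc (i + 1)) := fun he =>
        hlt.ne (AddSubgroup.eq_of_le_of_card_ge hlt.le he.ge)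
      rw [hk] at h hd hne
      rw [hl] at hd hne ⊢
      have hik : i ≤ k := (Nat.pow_le_pow_iff_right hp.one_lt).1 h
      have hkl : k ≤ l := (Nat.pow_dvd_pow_iff_le_right hp.one_lt).1 hd
      have : k ≠ l := fun h => hne (by rw [h])
      exact Nat.pow_le_pow_right hp.pos (by omega)

lemma upc_top {p n : ℕ} (hp : p.Prime) (hcard : Nat.card A = p ^ n) : B.upc n = ⊤ := by
  have hfin : Finite A := Nat.finite_of_card_ne_zero (by rw [hcard]; exact pow_ne_zero _ hp.ne_zero)
  rcases B.upc_card hp hcard n with h | h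
  · exact h
  · exact AddSubgroup.eq_top_of_le_card _ (by rw [hcard]; exact h)

lemma star_eq (a b : A) : B.star a b = B.lam a b - b := rfl

lemma chain_le_upc {n : ℕ} (h : B.upc n = ⊤) (k l : ℕ) (hkl : k + l = n) :
    braceChainAux B k ≤ B.upc l := by
  induction k generalizing l with
  | zero => rw [show l = n by omega, h]; exact le_top
  | succ k ih =>
    have := ih (l + 1) (by omega)
    unfold braceChainAux
    rw [AddSubgroup.closure_le]
    rintro z ⟨x, y, hy, rfl⟩
    rw [star_eq]
    exact this hy x

lemma chain_bot {p n : ℕ} (hp : p.Prime) (hcard : Nat.card A = p ^ n) :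
    braceChainAux B n = ⊥ :=
  le_bot_iff.1 (B.chain_le_upc (B.upc_top hp hcard) n 0 (by omega))

lemma chain_anti1 (k : ℕ) : braceChainAux B (k + 1) ≤ braceChainAux B k := by
  induction k with
  | zero => exact le_top
  | succ k ih =>
    rw [braceChainAux, AddSubgroup.closure_le]
    rintro z ⟨x, y, hy, rfl⟩
    rw [braceChainAux]
    exact AddSubgroup.subset_closure ⟨x, y, ih hy, rfl⟩

lemma chain_anti {k l : ℕ} (h : k ≤ l) : braceChainAux B l ≤ braceChainAux B k :=
  antitone_nat_of_succ_le (f := braceChainAux B) B.chain_anti1 h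

/-- Chain in `A × ℤ`. -/
def vch : ℕ → AddSubgroup (A × ℤ)
  | 0 => ⊤
  | k + 1 => (braceChainAux B k).prod ⊥

lemma mem_vch_succ (k : ℕ) (v : A × ℤ) :
    v ∈ B.vch (k + 1) ↔ v.1 ∈ braceChainAux B k ∧ v.2 = 0 := by
  rw [vch, AddSubgroup.mem_prod, AddSubgroup.mem_bot]

lemma vch_anti {k l : ℕ} (h : k ≤ l) : B.vch l ≤ B.vch k := by
  cases k with
  | zero => exact le_top
  | succ k =>
    obtain ⟨l, rfl⟩ : ∃ j, l = j + 1 := ⟨l - 1, by omega⟩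
    intro v hv
    rw [mem_vch_succ] at hv ⊢
    exact ⟨B.chain_anti (by omega) hv.1, hv.2⟩

/-- Filtration on endomorphisms of `A × ℤ`. -/
def filt {p n : ℕ} (hp : p.Prime) (hn : n < p - 1) (hcard : Nat.card A = p ^ n) :
    Filt (AddMonoid.End (A × ℤ)) p n where
  F i :=
    { carrier := {r | ∀ k, ∀ v ∈ B.vch k, r v ∈ B.vch (k + i)}
      zero_mem' := fun k v _ => zero_mem _
      add_mem' := fun hr hs k v hv => add_mem (hr k v hv) (hs k v hv)
      neg_mem' := fun hr k v hv => neg_mem (hr k v hv) }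
  one_mem := fun k v hv => hv
  mul_mem := by
    intro i j x y hx hy k v hv
    have := hx _ _ (hy k v hv)
    rw [show k + (i + j) = k + j + i by omega]
    exact this
  anti := fun hij r hr k v hv => B.vch_anti (by omega) (hr k v hv)
  top := by
    rw [eq_bot_iff]
    intro r hr
    rw [AddSubgroup.mem_bot]
    ext1 v
    have h1 := hr 0 v trivial
    rw [zero_add] at h1
    have h2 := B.vch_anti (show n + 1 ≤ p by omega) h1
    rw [mem_vch_succ, B.chain_bot hp hcard, AddSubgroup.mem_bot] at h2
    exact Prod.ext h2.1 h2.2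
  tors := by
    intro r hr
    ext1 v
    have h1 := hr 0 v trivial
    rw [zero_add, mem_vch_succ] at h1
    change p ^ n • r v = 0
    refine Prod.ext ?_ ?_
    · change p ^ n • (r v).1 = 0
      rw [← hcard]
      exact card_nsmul_eq_zero'
    · change p ^ n • (r v).2 = 0
      rw [h1.2, smul_zero]

/-- Affine transformation of `a`. -/
def aff (a : A) : AddMonoid.End (A × ℤ) where
  toFun v := (B.lam a v.1 + v.2 • a, v.2)
  map_zero' := by simp
  map_add' v w := by
    refine Prod.ext ?_ ?_
    · simp only [Prod.fst_add, Prod.snd_add, map_add, add_smul]; abel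
    · simp

lemma aff_apply (a b : A) (s : ℤ) : B.aff a (b, s) = (B.lam a b + s • a, s) := rfl

/-- The regular subgroup. -/
def affG : Submonoid (AddMonoid.End (A × ℤ)) where
  carrier := Set.range B.aff
  one_mem' := by
    refine ⟨0, ?_⟩
    ext1 v
    rcases v with ⟨b, s⟩
    rw [aff_apply, lam_zero, smul_zero, add_zero]; rfl
  mul_mem' := by
    rintro _ _ ⟨a, rfl⟩ ⟨b, rfl⟩
    refine ⟨B.circ a b, ?_⟩
    ext1 v
    rcases v with ⟨c, s⟩
    change _ = B.aff a (B.aff b (c, s))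
    rw [aff_apply, aff_apply, aff_apply, lam_circ, B.circ_eq a b, map_add, map_zsmul, smul_add]
    congr 1
    abel

lemma aff_mem {p n : ℕ} (hp : p.Prime) (hn : n < p - 1) (hcard : Nat.card A = p ^ n) (a : A) :
    B.aff a - 1 ∈ (B.filt hp hn hcard).F 1 := by
  intro k v hv
  rw [mem_vch_succ]
  rcases v with ⟨b, s⟩
  change (B.lam a b + s • a) - b ∈ _ ∧ s - s = 0
  refine ⟨?_, sub_self s⟩
  cases k with
  | zero => trivial
  | succ k =>
    rw [mem_vch_succ] at hv
    obtain ⟨h1, h2⟩ := hv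
    simp only at h1 h2
    rw [h2, zero_smul, add_zero]
    rw [braceChainAux]
    exact AddSubgroup.subset_closure ⟨a, b, h1, rfl⟩

end LeftBrace

lemma sum_range_eq_Icc {M : Type*} [AddCommMonoid M] {p : ℕ} (hp : 1 ≤ p) (f : ℕ → M) :
    ∑ k ∈ Finset.range p, f k = f 0 + ∑ k ∈ Finset.Icc 1 (p - 1), f k := by
  have : Finset.range p = insert 0 (Finset.Icc 1 (p - 1)) := by
    ext k
    simp only [Finset.mem_range, Finset.mem_insert, Finset.mem_Icc]
    omega
  rw [this, Finset.sum_insert (by simp)]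

namespace LeftBrace

variable {A : Type u} [AddCommGroup A] (B : LeftBrace A)

/-- Linear part of an endomorphism of `A × ℤ`. -/
def linp (x : AddMonoid.End (A × ℤ)) (b : A) : A := (x (b, 0)).1

/-- Translation part of an endomorphism of `A × ℤ`. -/
def trp (x : AddMonoid.End (A × ℤ)) : A := (x (0, 1)).1

lemma mem_F1 {p n : ℕ} (hp : p.Prime) (hn : n < p - 1) (hcard : Nat.card A = p ^ n)
    {x : AddMonoid.End (A × ℤ)} (hx : x ∈ (B.filt hp hn hcard).F 1) (v : A × ℤ) :
    (x v).2 = 0 := by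
  have h1 := hx 0 v trivial
  rw [zero_add, mem_vch_succ] at h1
  exact h1.2

lemma apply_lin {p n : ℕ} (hp : p.Prime) (hn : n < p - 1) (hcard : Nat.card A = p ^ n)
    {x : AddMonoid.End (A × ℤ)} (hx : x ∈ (B.filt hp hn hcard).F 1) (b : A) :
    x (b, 0) = (linp x b, 0) := Prod.ext rfl (B.mem_F1 hp hn hcard hx _)

lemma apply_tr {p n : ℕ} (hp : p.Prime) (hn : n < p - 1) (hcard : Nat.card A = p ^ n)
    {x : AddMonoid.End (A × ℤ)} (hx : x ∈ (B.filt hp hn hcard).F 1) :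
    x (0, 1) = (trp x, 0) := Prod.ext rfl (B.mem_F1 hp hn hcard hx _)

lemma pow_lin {p n : ℕ} (hp : p.Prime) (hn : n < p - 1) (hcard : Nat.card A = p ^ n)
    {x : AddMonoid.End (A × ℤ)} (hx : x ∈ (B.filt hp hn hcard).F 1) (b : A) (k : ℕ) :
    (x ^ k) (b, 0) = ((linp x)^[k] b, 0) := by
  induction k generalizing b with
  | zero => rfl
  | succ k ih =>
    rw [pow_succ, Function.iterate_succ_apply]
    change (x ^ k) (x (b, 0)) = _
    rw [B.apply_lin hp hn hcard hx, ih]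

lemma pow_tr {p n : ℕ} (hp : p.Prime) (hn : n < p - 1) (hcard : Nat.card A = p ^ n)
    {x : AddMonoid.End (A × ℤ)} (hx : x ∈ (B.filt hp hn hcard).F 1) (k : ℕ) :
    (x ^ (k + 1)) (0, 1) = ((linp x)^[k] (trp x), 0) := by
  rw [pow_succ]
  change (x ^ k) (x (0, 1)) = _
  rw [B.apply_tr hp hn hcard hx, B.pow_lin hp hn hcard hx]

lemma tE_apply {p n : ℕ} (hp : p.Prime) (x : AddMonoid.End (A × ℤ)) (v : A × ℤ) :
    tE p n x v = v + ∑ k ∈ Finset.Icc 1 (p - 1), ifac p n k • (x ^ k) v := by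
  have h : tE p n x v = ∑ k ∈ Finset.range p, ifac p n k • (x ^ k) v := by
    unfold tE
    exact AddMonoidHom.finsetSum_apply _ _ _
  rw [h, sum_range_eq_Icc hp.one_le]
  simp [ifac]

lemma tE_lin {p n : ℕ} (hp : p.Prime) (hn : n < p - 1) (hcard : Nat.card A = p ^ n)
    {x : AddMonoid.End (A × ℤ)} (hx : x ∈ (B.filt hp hn hcard).F 1) (b : A) :
    (tE p n x (b, 0)).1 = b + ∑ k ∈ Finset.Icc 1 (p - 1), ifac p n k • (linp x)^[k] b := by
  rw [tE_apply hp, Prod.fst_add, Prod.fst_sum]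
  congr 1
  refine Finset.sum_congr rfl fun k _ => ?_
  rw [B.pow_lin hp hn hcard hx]; rfl

lemma tE_tr {p n : ℕ} (hp : p.Prime) (hn : n < p - 1) (hcard : Nat.card A = p ^ n)
    {x : AddMonoid.End (A × ℤ)} (hx : x ∈ (B.filt hp hn hcard).F 1) :
    (tE p n x (0, 1)).1 =
      ∑ k ∈ Finset.Icc 1 (p - 1), ifac p n k • (linp x)^[k - 1] (trp x) := by
  rw [tE_apply hp, Prod.fst_add, Prod.fst_sum]
  rw [zero_add]
  refine Finset.sum_congr rfl fun k hk => ?_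
  obtain ⟨k, rfl⟩ : ∃ j, k = j + 1 := ⟨k - 1, by have := (Finset.mem_Icc.1 hk).1; omega⟩
  rw [B.pow_tr hp hn hcard hx]; rfl

/-- The brace itself is the group of flows of a pre-Lie ring. -/
theorem flows {p n : ℕ} (hp : p.Prime) (hn : n < p - 1) (hcard : Nat.card A = p ^ n) :
    ∃ (mul : A → A → A) (Ω : A → A),
    (∀ x y z, mul (x + y) z = mul x z + mul y z) ∧
    (∀ x y z, mul x (y + z) = mul x y + mul x z) ∧
    (∀ x y z, mul (mul x y) z - mul x (mul y z) = mul (mul y x) z - mul y (mul x z)) ∧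
    (∀ (l : List A) (b : A), l.length = n → leftProd mul l b = 0) ∧
    Function.Bijective Ω ∧
    (∀ a, ∑ k ∈ Finset.Icc 1 (p - 1), ifac p n k • (mul (Ω a))^[k - 1] (Ω a) = a) ∧
    (∀ a b, B.circ a b = a + b + ∑ k ∈ Finset.Icc 1 (p - 1), ifac p n k • (mul (Ω a))^[k] b) := by
  have hfin : Finite A := Nat.finite_of_card_ne_zero (by rw [hcard]; exact pow_ne_zero _ hp.ne_zero)
  set Φ := B.filt hp hn hcard with hΦ
  -- the Lie ring
  let 𝔤 : AddSubgroup (AddMonoid.End (A × ℤ)) :=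
    { carrier := {x | x ∈ Φ.F 1 ∧ tE p n x ∈ B.affG}
      zero_mem' := ⟨zero_mem _, by rw [Filt.tE_zero hp]; exact B.affG.one_mem⟩
      add_mem' := fun hx hy => ⟨add_mem hx.1 hy.1, Φ.add_closed hp B.affG hx.1 hy.1 hx.2 hy.2⟩
      neg_mem' := fun hx => ⟨neg_mem hx.1, Φ.neg_closed hp B.affG hx.1 hx.2⟩ }
  have h𝔤b : ∀ x ∈ 𝔤, ∀ y ∈ 𝔤, x * y - y * x ∈ 𝔤 := fun x hx y hy =>
    ⟨Φ.anti (by omega) (sub_mem (Φ.mul_mem hx.1 hy.1) (Φ.mul_mem hy.1 hx.1)),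
      Φ.bracket_closed hp B.affG hx.1 hy.1 hx.2 hy.2⟩
  choose ψ hψ1 hψ using fun a => Φ.tE_exists hp (B.aff_mem hp hn hcard a)
  have hψ𝔤 : ∀ a, ψ a ∈ 𝔤 := fun a => ⟨hψ1 a, by rw [hψ]; exact ⟨a, rfl⟩⟩
  -- translation part is injective on `𝔤`
  have htr0 : ∀ x ∈ 𝔤, trp x = 0 → x = 0 := by
    rintro x ⟨hx, a, ha⟩ h0
    have h1 := B.tE_tr hp hn hcard hx
    rw [← ha, h0, aff_apply] at h1
    have hz : ∀ k, (linp x)^[k] 0 = 0 := by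
      intro k
      have := congrArg Prod.fst (B.pow_lin hp hn hcard hx 0 k)
      refine this.symm.trans ?_
      change ((x ^ k) 0).1 = 0
      rw [map_zero]; rfl
    simp only [hz, smul_zero, Finset.sum_const_zero, map_zero, one_smul, zero_add] at h1
    subst h1
    apply Φ.tE_inj hp hx (zero_mem _)
    rw [← ha, Filt.tE_zero hp]
    ext1 v
    rcases v with ⟨b, s⟩
    rw [aff_apply, lam_zero, smul_zero, add_zero]; rfl
  have htr : ∀ x ∈ 𝔤, ∀ y ∈ 𝔤, trp x = trp y → x = y := by
    intro x hx y hy h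
    apply sub_eq_zero.1
    apply htr0 _ (sub_mem hx hy)
    change trp x - trp y = 0
    rw [h, sub_self]
  have haff : Function.Injective B.aff := by
    intro a b h
    have := congrArg Prod.fst (DFunLike.congr_fun h ((0 : A), (1 : ℤ)))
    simpa [aff_apply] using this
  have hΩ : Function.Bijective (fun a => trp (ψ a)) := by
    apply Function.Injective.bijective_of_finite
    intro a b h
    have := htr _ (hψ𝔤 a) _ (hψ𝔤 b) h
    apply haff
    rw [← hψ a, ← hψ b, this]
  choose inv hinv using hΩ.2
  set Λ : A → AddMonoid.End (A × ℤ) := fun w => ψ (inv w) with hΛ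
  have hΛ𝔤 : ∀ w, Λ w ∈ 𝔤 := fun w => hψ𝔤 _
  have hΛt : ∀ w, trp (Λ w) = w := fun w => hinv w
  have hΛu : ∀ x ∈ 𝔤, ∀ w, trp x = w → Λ w = x := fun x hx w h =>
    htr _ (hΛ𝔤 w) _ hx (by rw [hΛt, h])
  have hΛψ : ∀ a, Λ (trp (ψ a)) = ψ a := fun a => hΛu _ (hψ𝔤 a) _ rfl
  refine ⟨fun w b => linp (Λ w) b, fun a => trp (ψ a), ?_, ?_, ?_, ?_, hΩ, ?_, ?_⟩
  · intro x y z
    have : Λ (x + y) = Λ x + Λ y := hΛu _ (add_mem (hΛ𝔤 x) (hΛ𝔤 y)) _ (by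
      change trp (Λ x) + trp (Λ y) = _
      rw [hΛt, hΛt])
    simp only [this]
    rfl
  · intro x y z
    change ((Λ x) (y + z, 0)).1 = ((Λ x) (y, 0)).1 + ((Λ x) (z, 0)).1
    rw [← Prod.fst_add, ← map_add, Prod.mk_add_mk, add_zero]
  · intro x y z
    have h1 : Λ (linp (Λ x) y - linp (Λ y) x) = Λ x * Λ y - Λ y * Λ x := by
      apply hΛu _ (h𝔤b _ (hΛ𝔤 x) _ (hΛ𝔤 y))
      change ((Λ x) ((Λ y) (0, 1))).1 - ((Λ y) ((Λ x) (0, 1))).1 = _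
      rw [B.apply_tr hp hn hcard (hΛ𝔤 x).1, B.apply_tr hp hn hcard (hΛ𝔤 y).1, hΛt, hΛt]
      rfl
    have h2 : Λ (linp (Λ x) y - linp (Λ y) x) = Λ (linp (Λ x) y) - Λ (linp (Λ y) x) :=
      hΛu _ (sub_mem (hΛ𝔤 _) (hΛ𝔤 _)) _ (by
        change trp (Λ _) - trp (Λ _) = _
        rw [hΛt, hΛt])
    rw [h1] at h2
    have h3 : linp (Λ x * Λ y - Λ y * Λ x) z =
        linp (Λ (linp (Λ x) y)) z - linp (Λ (linp (Λ y) x)) z := by rw [h2]; rfl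
    have h4 : linp (Λ x * Λ y - Λ y * Λ x) z =
        linp (Λ x) (linp (Λ y) z) - linp (Λ y) (linp (Λ x) z) := by
      change ((Λ x) ((Λ y) (z, 0))).1 - ((Λ y) ((Λ x) (z, 0))).1 = _
      rw [B.apply_lin hp hn hcard (hΛ𝔤 x).1, B.apply_lin hp hn hcard (hΛ𝔤 y).1]
      rfl
    rw [h4] at h3
    simp only
    rw [sub_eq_sub_iff_add_eq_add] at h3 ⊢
    rw [add_comm] at h3
    rw [h3, add_comm]
  · intro l b hl
    have : (leftProd (fun w b => linp (Λ w) b) l b, (0 : ℤ)) ∈ B.vch (l.length + 1) := by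
      clear hl
      induction l with
      | nil => exact ⟨trivial, rfl⟩
      | cons a l ih =>
        have := (hΛ𝔤 a).1 _ _ ih
        rw [B.apply_lin hp hn hcard (hΛ𝔤 a).1] at this
        exact this
    rw [hl, mem_vch_succ, B.chain_bot hp hcard] at this
    exact this.1
  · intro a
    simp only [hΛψ]
    rw [← B.tE_tr hp hn hcard (hψ1 a), hψ, aff_apply, map_zero, zero_add, one_smul]
  · intro a b
    simp only [hΛψ]
    rw [add_assoc]
    have := B.tE_lin hp hn hcard (hψ1 a) b
    rw [hψ, aff_apply, zero_smul, add_zero] at this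
    rw [B.circ_eq]
    congr 1

end LeftBrace

lemma qmk_eq {A : Type u} [AddCommGroup A] {K : ℕ} {a b : A} :
    qmk K a = qmk K b ↔ K • (a - b) = 0 := by
  unfold qmk
  rw [eq_comm, QuotientAddGroup.eq, neg_add_eq_sub]
  rfl

/-- for a left brace `A` of cardinality `p^n` with `n < p−1`, there is a
left nilpotent pre-Lie ring structure `mul` on the additive group of the factor brace
`A/ann(p⁴)` whose group of flows has the same multiplication as the factor brace.
The group of flows is encoded as follows: `invf k` is the (unique) inverse of
multiplication by `k!` on `A/ann(p⁴)` (for `k < p`), `Ω` is the inverse of the function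
`W(x) = Σ_{k≥1} (1/k!)·L_x^{k−1}(x)`, and
`a∘b = a + b + Σ_{k≥1} (1/k!)·L_{Ω(a)}^k(b)`; all sums terminate by `k = p−1` since left
nilpotent pre-Lie rings of cardinality `p^n` with `n+1 < p` have nilpotency index `< p`. -/
theorem stmt_0 (p n : ℕ) (hp : p.Prime) (hn : n < p - 1)
    (A : Type u) [AddCommGroup A] (B : LeftBrace A) (hcard : Nat.card A = p ^ n) :
    ∃ circQ : (A ⧸ annSub A (p ^ 4)) → (A ⧸ annSub A (p ^ 4)) → (A ⧸ annSub A (p ^ 4)),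
      -- circQ is the multiplication of the factor brace A/ann(p⁴)
      (∀ a b : A, circQ (qmk (p ^ 4) a) (qmk (p ^ 4) b) = qmk (p ^ 4) (B.circ a b)) ∧
      ∃ mul : (A ⧸ annSub A (p ^ 4)) → (A ⧸ annSub A (p ^ 4)) → (A ⧸ annSub A (p ^ 4)),
        -- mul is biadditive
        (∀ x y z : A ⧸ annSub A (p ^ 4), mul (x + y) z = mul x z + mul y z) ∧
        (∀ x y z : A ⧸ annSub A (p ^ 4), mul x (y + z) = mul x y + mul x z) ∧
        -- mul satisfies the pre-Lie identity
        (∀ x y z : A ⧸ annSub A (p ^ 4),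
          mul (mul x y) z - mul x (mul y z) = mul (mul y x) z - mul y (mul x z)) ∧
        -- mul is left nilpotent
        (∃ m : ℕ, ∀ (l : List (A ⧸ annSub A (p ^ 4))) (b : A ⧸ annSub A (p ^ 4)),
          l.length = m → leftProd mul l b = 0) ∧
        -- circQ is the multiplication of the group of flows of mul
        ∃ (Ω : (A ⧸ annSub A (p ^ 4)) → (A ⧸ annSub A (p ^ 4)))
          (invf : ℕ → (A ⧸ annSub A (p ^ 4)) → (A ⧸ annSub A (p ^ 4))),
          -- invf k is division by k!
          (∀ k : ℕ, k < p → ∀ x : A ⧸ annSub A (p ^ 4), (Nat.factorial k) • invf k x = x) ∧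
          -- Ω is the inverse function of W
          (∀ a : A ⧸ annSub A (p ^ 4),
            ∑ k ∈ Finset.Icc 1 (p - 1),
              invf k ((fun y => mul (Ω a) y)^[k - 1] (Ω a)) = a) ∧
          (∀ x : A ⧸ annSub A (p ^ 4),
            Ω (∑ k ∈ Finset.Icc 1 (p - 1),
              invf k ((fun y => mul x y)^[k - 1] x)) = x) ∧
          -- the group-of-flows formula
          (∀ a b : A ⧸ annSub A (p ^ 4),
            circQ a b = a + b + ∑ k ∈ Finset.Icc 1 (p - 1),
              invf k ((fun y => mul (Ω a) y)^[k] b)) := by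
  have hfin : Finite A := Nat.finite_of_card_ne_zero (by rw [hcard]; exact pow_ne_zero _ hp.ne_zero)
  obtain ⟨mul, Ω, hadd, hadd', hpl, hnil, hΩ, hW, hflow⟩ := B.flows hp hn hcard
  generalize p ^ 4 = K
  let Q := A ⧸ annSub A K
  let π : A →+ Q := QuotientAddGroup.mk' (annSub A K)
  have hπ : ∀ a, qmk K a = π a := fun _ => rfl
  have hsurj : Function.Surjective π := QuotientAddGroup.mk'_surjective _
  choose s hs using hsurj
  have hl0 : ∀ z (k : ℕ) x, mul (k • x) z = k • mul x z := by
    intro z k x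
    exact map_nsmul (⟨⟨fun x => mul x z, by simpa using hadd 0 0 z⟩, fun x y => hadd x y z⟩ : A →+ A) k x
  have hr0 : ∀ z (k : ℕ) x, mul z (k • x) = k • mul z x := by
    intro z k x
    exact map_nsmul (⟨⟨fun x => mul z x, by simpa using hadd' z 0 0⟩, fun x y => hadd' z x y⟩ : A →+ A) k x
  have hz1 : ∀ z, mul 0 z = 0 := fun z => by simpa using hl0 z 0 0
  have hz2 : ∀ z, mul z 0 = 0 := fun z => by simpa using hr0 z 0 0
  have hπ0 : ∀ a b, π a = π b ↔ K • (a - b) = 0 := fun a b => qmk_eq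
  have hwd1 : ∀ a a' b, π a = π a' → π (mul a b) = π (mul a' b) := by
    intro a a' b h
    rw [hπ0] at h ⊢
    have e : mul a b - mul a' b = mul (a - a') b := by
      rw [sub_eq_iff_eq_add, ← hadd, sub_add_cancel]
    rw [e, ← hl0, h, hz1]
  have hwd2 : ∀ a b b', π b = π b' → π (mul a b) = π (mul a b') := by
    intro a b b' h
    rw [hπ0] at h ⊢
    have e : mul a b - mul a b' = mul a (b - b') := by
      rw [sub_eq_iff_eq_add, ← hadd', sub_add_cancel]
    rw [e, ← hr0, h, hz2]
  let mulQ : Q → Q → Q := fun x y => π (mul (s x) (s y))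
  have hmul : ∀ a b, mulQ (π a) (π b) = π (mul a b) := by
    intro a b
    exact (hwd1 _ _ _ (hs _)).trans (hwd2 _ _ _ (hs _))
  have hiter : ∀ k x b, (fun y => mulQ (π x) y)^[k] (π b) = π ((mul x)^[k] b) := by
    intro k x b
    induction k with
    | zero => rfl
    | succ k ih => rw [Function.iterate_succ_apply', Function.iterate_succ_apply', ih, hmul]
  let WQ : Q → Q := fun x => ∑ k ∈ Finset.Icc 1 (p - 1),
    ifac p n k • (fun y => mulQ x y)^[k - 1] x
  have hWQ : ∀ a, WQ (π (Ω a)) = π a := by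
    intro a
    change ∑ k ∈ Finset.Icc 1 (p - 1), ifac p n k • (fun y => mulQ (π (Ω a)) y)^[k - 1] (π (Ω a)) = _
    conv_rhs => rw [← hW a, map_sum]
    refine Finset.sum_congr rfl fun k _ => ?_
    rw [hiter, map_nsmul]
  have hWs : Function.Surjective WQ := fun x => ⟨π (Ω (s x)), by rw [hWQ, hs]⟩
  have hQfin : Finite Q := Finite.of_surjective π (QuotientAddGroup.mk'_surjective _)
  have hWi : Function.Injective WQ := Finite.injective_iff_surjective.2 hWs
  let ΩQ : Q → Q := fun x => π (Ω (s x))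
  have hΩ1 : ∀ x, WQ (ΩQ x) = x := fun x => (hWQ _).trans (hs x)
  have hΩ2 : ∀ x, ΩQ (WQ x) = x := fun x => hWi (hΩ1 _)
  have hΩπ : ∀ a, ΩQ (π a) = π (Ω a) := fun a => hWi (by rw [hΩ1, hWQ])
  let circQ : Q → Q → Q := fun a b => a + b + ∑ k ∈ Finset.Icc 1 (p - 1),
    ifac p n k • (fun y => mulQ (ΩQ a) y)^[k] b
  refine ⟨circQ, ?_, mulQ, ?_, ?_, ?_, ⟨n, ?_⟩, ΩQ, fun k x => ifac p n k • x, ?_, hΩ1, hΩ2,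
    fun a b => rfl⟩
  · intro a b
    rw [hπ, hπ, hπ, hflow, map_add, map_add, map_sum]
    change π a + π b + ∑ k ∈ Finset.Icc 1 (p - 1),
      ifac p n k • (fun y => mulQ (ΩQ (π a)) y)^[k] (π b) = _
    rw [hΩπ]
    congr 1
    refine Finset.sum_congr rfl fun k _ => ?_
    rw [hiter, map_nsmul]
  · intro x y z
    rw [← hs x, ← hs y, ← hs z, ← map_add, hmul, hmul, hmul, hadd, map_add]
  · intro x y z
    rw [← hs x, ← hs y, ← hs z, ← map_add, hmul, hmul, hmul, hadd', map_add]
  · intro x y z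
    rw [← hs x, ← hs y, ← hs z]
    simp only [hmul]
    rw [← map_sub, ← map_sub, hpl]
  · intro l b hl
    have : ∀ l : List Q, leftProd mulQ l b = π (leftProd mul (l.map s) (s b)) := by
      intro l
      induction l with
      | nil => exact (hs b).symm
      | cons a l ih =>
        change mulQ a (leftProd mulQ l b) = π (mul (s a) (leftProd mul (l.map s) (s b)))
        rw [ih, ← hmul, hs]
    rw [this, hnil _ _ (by simpa using hl), map_zero]
  · intro k hk x
    change Nat.factorial k • ifac p n k • x = x
    rw [← hs x, ← map_nsmul, ← map_nsmul]
    congr 1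
    rw [smul_smul]
    have h1 := ifac_spec (m := n) hp hk
    have h2 : ((Nat.factorial k * ifac p n k : ℕ) : ZMod (p ^ n)) = ((1 : ℕ) : ZMod (p ^ n)) := by
      push_cast; rw [mul_comm]; exact h1
    rw [ZMod.natCast_eq_natCast_iff] at h2
    have h3 : addOrderOf (s x) ∣ p ^ n := hcard ▸ addOrderOf_dvd_natCard (s x)
    have h4 := (nsmul_eq_nsmul_iff_modEq (x := s x)).2 (h2.of_dvd h3)
    rw [h4, one_smul]
end

section
/- Let p be a prime number and (A,+,∘) a left brace of cardinality p^n with p > n+1. Then the map A/ann(p^2) → A/ann(p^2) given by [a] ↦ [f(a)] is well defined and injective, hence (A/ann(p^2) being finite) bijective. In particular, for a, b ∈ A, if f(a) − f(b) ∈ ann(p^2) then a − b ∈ ann(p^2). -/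
universe u

namespace BraceAux

section ringlemma
variable {E : Type*} [Ring E]

theorem pow_sub_pow_expand (x y : E) (i : ℕ) :
    x ^ (i+1) - y ^ (i+1) = ∑ j ∈ Finset.range (i+1), x ^ j * (x - y) * y ^ (i - j) := by
  induction i with
  | zero => simp
  | succ i ih =>
    rw [Finset.sum_range_succ]
    have : ∑ j ∈ Finset.range (i+1), x ^ j * (x - y) * y ^ (i + 1 - j)
        = (∑ j ∈ Finset.range (i+1), x ^ j * (x - y) * y ^ (i - j)) * y := by
      rw [Finset.sum_mul]
      refine Finset.sum_congr rfl fun j hj => ?_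
      have : j ≤ i := by simp at hj; omega
      rw [Nat.sub_add_comm this, pow_succ]; simp only [mul_assoc]
    rw [this, ← ih]
    simp only [Nat.sub_self, pow_zero, mul_one]
    rw [pow_succ y (i+1), pow_succ x (i+1)]
    noncomm_ring

theorem filt_pow (P : ℕ → AddSubgroup E) (h1 : (1 : E) ∈ P 0)
    (hmul : ∀ j l x y, x ∈ P j → y ∈ P l → x * y ∈ P (j + l)) {x : E} (hx : x ∈ P 1) (k : ℕ) :
    x ^ k ∈ P k := by
  induction k with
  | zero => simpa using h1
  | succ k ih => rw [pow_succ]; exact hmul _ _ _ _ ih hx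

/-- the polynomial with coefficients `c` -/
def gg (c : ℕ → ℕ) (m : ℕ) (x : E) : E := ∑ i ∈ Finset.Icc 1 m, c i • x ^ i

theorem cancel (P : ℕ → AddSubgroup E) (h1 : (1 : E) ∈ P 0)
    (hmul : ∀ j l x y, x ∈ P j → y ∈ P l → x * y ∈ P (j + l)) (N : ℕ)
    (hN : ∀ k, N ≤ k → ∀ x ∈ P k, x = 0) {x y : E} (hx : x ∈ P 1) (hy : y ∈ P 1)
    (q : ℕ) (c : ℕ → ℕ) (hc : c 1 = 1) (m : ℕ) (hm : 1 ≤ m)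
    (h : q • gg c m x = q • gg c m y) : q • (x - y) = 0 := by
  have hD : x - y ∈ P 1 := (P 1).sub_mem hx hy
  have key : q • (x - y) = - ∑ i ∈ Finset.Icc 2 m, c i • (q • (x ^ i - y ^ i)) := by
    unfold gg at h
    rw [← Finset.add_sum_Ioc_eq_sum_Icc hm, ← Finset.add_sum_Ioc_eq_sum_Icc hm] at h
    have e : Finset.Icc 2 m = Finset.Ioc 1 m := by ext; simp; omega
    rw [e]
    simp only [hc, one_smul, pow_one, smul_add] at h
    have : ∑ i ∈ Finset.Ioc 1 m, c i • (q • (x ^ i - y ^ i))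
       = q • (∑ i ∈ Finset.Ioc 1 m, c i • x ^ i) - q • (∑ i ∈ Finset.Ioc 1 m, c i • y ^ i) := by
      rw [Finset.smul_sum, Finset.smul_sum, ← Finset.sum_sub_distrib]
      refine Finset.sum_congr rfl fun i _ => ?_
      rw [smul_sub, smul_sub, smul_comm q, smul_comm q (c i)]
    rw [this, smul_sub, neg_sub, sub_eq_sub_iff_add_eq_add, h]
    abel
  have main : ∀ t k, N ≤ k + t → ∀ j l, k ≤ j + l → ∀ u ∈ P j, ∀ v ∈ P l,
      q • (u * (x - y) * v) = 0 := by
    intro t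
    induction t with
    | zero =>
      intro k hk j l hjl u hu v hv
      rw [hN (j + 1 + l) (by omega) _ (hmul _ _ _ _ (hmul _ _ _ _ hu hD) hv), smul_zero]
    | succ t ih =>
      intro k hk j l hjl u hu v hv
      have e1 : q • (u * (x - y) * v) = u * (q • (x - y)) * v := by
        rw [mul_smul_comm, smul_mul_assoc]
      rw [e1, key, mul_neg, neg_mul, Finset.mul_sum, Finset.sum_mul, neg_eq_zero]
      refine Finset.sum_eq_zero fun i hi => ?_
      obtain ⟨i, rfl⟩ : ∃ i', i = i' + 1 := ⟨i - 1, by simp at hi; omega⟩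
      rw [pow_sub_pow_expand, mul_smul_comm, smul_mul_assoc, mul_smul_comm, smul_mul_assoc,
        Finset.mul_sum, Finset.sum_mul, Finset.smul_sum]
      rw [Finset.sum_eq_zero, smul_zero]
      intro s hs
      have e2 : u * (x ^ s * (x - y) * y ^ (i - s)) * v
          = (u * x ^ s) * (x - y) * (y ^ (i - s) * v) := by simp only [mul_assoc]
      rw [e2]
      refine ih (k + 1) (by omega) (j + s) ((i - s) + l) ?_ _
        (hmul _ _ _ _ hu (filt_pow P h1 hmul hx s)) _ (hmul _ _ _ _ (filt_pow P h1 hmul hy _) hv)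
      simp at hi hs; omega
  have := main N 0 (by omega) 0 0 (by omega) 1 h1 1 h1
  simpa using this

theorem smul_pow_eq {x y : E} {q : ℕ} (h : q • x = q • y) (i : ℕ) : q • x ^ i = q • y ^ i := by
  induction i with
  | zero => simp
  | succ i ih =>
    rw [pow_succ, pow_succ, ← smul_mul_assoc, ih, smul_mul_assoc, ← mul_smul_comm, h,
      mul_smul_comm]

theorem smul_gg_eq {x y : E} {q : ℕ} (h : q • x = q • y) (c : ℕ → ℕ) (m : ℕ) :
    q • gg c m x = q • gg c m y := by
  unfold gg
  rw [Finset.smul_sum, Finset.smul_sum]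
  refine Finset.sum_congr rfl fun i _ => ?_
  rw [smul_comm, smul_pow_eq h, smul_comm]

theorem dvd_choose {p : ℕ} (hp : p.Prime) (k i : ℕ) (hi : 1 ≤ i) (hip : i < p) :
    p ^ k ∣ (p ^ k).choose i := by
  have h := Nat.add_one_mul_choose_eq (p ^ k - 1) (i - 1)
  have h0 : 0 < p ^ k := pow_pos hp.pos k
  rw [Nat.sub_add_cancel h0, Nat.sub_add_cancel hi] at h
  have hcop : Nat.Coprime (p ^ k) i := by
    apply Nat.Coprime.pow_left
    exact (Nat.coprime_of_lt_prime (by omega) hip hp)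
  exact hcop.dvd_of_dvd_mul_right ⟨_, h.symm⟩

theorem one_add_pow {p : ℕ} (hp : p.Prime) (k : ℕ) (hk : 1 ≤ k) (x : E) (hx : x ^ p = 0) :
    (1 + x) ^ (p ^ k) = 1 + (p ^ k) • gg (fun i => (p ^ k).choose i / p ^ k) (p - 1) x := by
  have hz : ∀ i, p ≤ i → x ^ i = 0 := fun i hi => pow_eq_zero_of_le hi hx
  have hle : p ≤ p ^ k := Nat.le_self_pow (by omega) p
  rw [add_comm 1 x, (Commute.one_right x).add_pow]
  have hp1 := hp.one_lt
  rw [← Finset.sum_subset (s₁ := Finset.range p)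
    (by intro i; simp; omega)
    (by intro i _ hi; rw [hz i (by simpa using hi)]; simp)]
  obtain ⟨r, rfl⟩ : ∃ r, p = r + 1 := ⟨p - 1, by omega⟩
  rw [Finset.sum_range_succ', add_comm]
  congr 1
  · simp
  · unfold gg
    rw [Finset.smul_sum, Finset.range_eq_Ico, Finset.sum_Ico_add' (fun i => x ^ i * 1 ^ ((r+1)^k - i) * (((r+1)^k).choose i : E)) 0 r 1]
    refine Finset.sum_congr (by ext; simp) fun i hi => ?_
    have hi' : 1 ≤ i ∧ i < r + 1 := by simp at hi; omega
    rw [smul_smul, Nat.mul_div_cancel' (dvd_choose hp k i hi'.1 hi'.2), one_pow, mul_one,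
      nsmul_eq_mul]
    exact (Nat.cast_commute _ _).eq.symm

end ringlemma

section brace
variable {A : Type u} [AddCommGroup A] (B : LeftBrace A)

theorem circ_zero (a : A) : B.circ a 0 = a := by
  have := B.circ_add a 0 0
  simpa using this.symm

theorem one_eq : B.one = 0 := by
  rw [← B.one_circ 0, circ_zero]

/-- lambda map -/
def lam (a : A) : A →+ A :=
  AddMonoidHom.mk' (fun v => B.circ a v - a) (by
    intro v w
    have := B.circ_add a v w
    rw [eq_sub_of_add_eq this]; abel)

theorem lam_apply (a v : A) : lam B a v = B.circ a v - a := rfl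

theorem lam_circ (a b v : A) : lam B (B.circ a b) v = lam B a (lam B b v) := by
  rw [lam_apply B b, map_sub, lam_apply, lam_apply, lam_apply, B.circ_assoc]; abel

theorem lam_zero (v : A) : lam B 0 v = v := by
  rw [lam_apply, ← one_eq B, B.one_circ, one_eq, sub_zero]

theorem star_eq (a v : A) : B.star a v = lam B a v - v := rfl

/-- circle group -/
@[reducible] def circGroup : Group A :=
  letI : Mul A := ⟨B.circ⟩
  letI : Inv A := ⟨B.inv⟩
  letI : One A := ⟨B.one⟩
  Group.ofLeftAxioms B.circ_assoc B.one_circ B.inv_circ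

/-- the ascending series -/
def V : ℕ → AddSubgroup A
  | 0 => ⊥
  | i + 1 =>
    { carrier := {v | ∀ a, B.star a v ∈ V i}
      zero_mem' := by intro a; simp [star_eq]
      add_mem' := by
        intro v w hv hw a
        have := (V i).add_mem (hv a) (hw a)
        rw [star_eq] at *
        rw [star_eq] at this
        rw [map_add]
        convert this using 1; abel
      neg_mem' := by
        intro v hv a
        have := (V i).neg_mem (hv a)
        rw [star_eq] at *
        rw [map_neg]
        convert this using 1; abel }

theorem mem_V_succ {i : ℕ} {v : A} : v ∈ V B (i+1) ↔ ∀ a, B.star a v ∈ V B i := Iff.rfl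

theorem V_mono (i : ℕ) : V B i ≤ V B (i+1) := by
  induction i with
  | zero => exact bot_le
  | succ i ih => exact fun v hv a => ih (hv a)

theorem V_lam (i : ℕ) (a v : A) (hv : v ∈ V B i) : lam B a v ∈ V B i := by
  have h := (V B i).add_mem (V_mono B i hv a) hv
  rwa [star_eq, sub_add_cancel] at h

theorem V_strict {p n : ℕ} (hp : p.Prime) (hcard : Nat.card A = p ^ n) (i : ℕ)
    (hi : V B i ≠ ⊤) : V B i < V B (i+1) := by
  haveI : Finite A := Nat.finite_of_card_ne_zero (by rw [hcard]; exact (pow_pos hp.pos n).ne')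
  haveI : Fact p.Prime := ⟨hp⟩
  refine lt_of_le_of_ne (V_mono B i) fun heq => ?_
  letI : Group A := circGroup B
  letI : MulAction A (A ⧸ V B i) :=
    { smul := fun g => QuotientAddGroup.map (V B i) (V B i) (lam B g) (fun v hv => V_lam B i g v hv)
      one_smul := by
        intro q
        induction q using QuotientAddGroup.induction_on with
        | H v =>
          change QuotientAddGroup.mk (lam B B.one v) = _
          rw [one_eq, lam_zero]
      mul_smul := by
        intro g h q
        induction q using QuotientAddGroup.induction_on with
        | H v =>
          change QuotientAddGroup.mk (lam B (B.circ g h) v)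
            = QuotientAddGroup.mk (lam B g (lam B h v))
          rw [lam_circ] }
  have hsm : ∀ (g v : A), g • (QuotientAddGroup.mk v : A ⧸ V B i)
    = QuotientAddGroup.mk (lam B g v) := fun g v => rfl
  have hG : IsPGroup p A := IsPGroup.of_card hcard
  have hdvd : p ∣ Nat.card (A ⧸ V B i) := by
    have h1 : Nat.card (A ⧸ V B i) ∣ p ^ n := hcard ▸ AddSubgroup.card_quotient_dvd_card _
    obtain ⟨k, _, hk⟩ := (Nat.dvd_prime_pow hp).1 h1
    rcases Nat.eq_zero_or_pos k with rfl | hk0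
    · exfalso; apply hi
      rw [pow_zero] at hk
      exact AddSubgroup.index_eq_one.1 hk
    · rw [hk]; exact dvd_pow_self p hk0.ne'
  obtain ⟨q, hq, hne⟩ := hG.exists_fixed_point_of_prime_dvd_card_of_fixed_point (A ⧸ V B i) hdvd
    (a := (QuotientAddGroup.mk 0 : A ⧸ V B i)) (by intro g; rw [hsm, map_zero])
  induction q using QuotientAddGroup.induction_on with
  | H v =>
    apply hne
    rw [QuotientAddGroup.eq, neg_zero, zero_add, heq]
    intro a
    have := hq a
    rw [hsm] at this
    have := QuotientAddGroup.eq.1 this.symm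
    rw [star_eq]
    convert this using 1; abel

theorem V_top {p n : ℕ} (hp : p.Prime) (hcard : Nat.card A = p ^ n) : V B n = ⊤ := by
  haveI : Finite A := Nat.finite_of_card_ne_zero (by rw [hcard]; exact (pow_pos hp.pos n).ne')
  have key : ∀ i, V B i = ⊤ ∨ p ^ i ≤ Nat.card (V B i) := by
    intro i
    induction i with
    | zero => right; simp [Nat.one_le_iff_ne_zero, Nat.card_pos.ne']
    | succ i ih =>
      by_cases ht : V B i = ⊤
      · left; exact top_le_iff.1 (ht ▸ V_mono B i)
      right
      have ih := ih.resolve_left ht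
      have hlt := V_strict B hp hcard i ht
      have hc : Nat.card (V B i) < Nat.card (V B (i+1)) := by
        refine lt_of_le_of_ne (AddSubgroup.card_le_of_le hlt.le) fun h => hlt.ne ?_
        exact AddSubgroup.eq_of_le_of_card_ge hlt.le h.ge
      obtain ⟨k, _, hk⟩ := (Nat.dvd_prime_pow hp).1 (hcard ▸ AddSubgroup.card_addSubgroup_dvd_card (V B (i+1)))
      rw [hk] at hc ⊢
      exact Nat.pow_le_pow_right hp.pos ((Nat.pow_lt_pow_iff_right hp.one_lt).1 (ih.trans_lt hc))
  rcases key n with h | h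
  · exact h
  · exact AddSubgroup.eq_top_of_le_card _ (hcard ▸ h)

/-- affine representation -/
def T (a : A) : Module.End ℤ (A × ℤ) :=
  AddMonoidHom.toIntLinearMap (AddMonoidHom.mk' (fun m => (lam B a m.1 + m.2 • a, m.2)) (by
    intro v w
    ext
    · simp only [Prod.fst_add, Prod.snd_add, map_add, add_smul]; abel
    · simp))

theorem T_apply (a : A) (m : A × ℤ) : T B a m = (lam B a m.1 + m.2 • a, m.2) := rfl

theorem T_circ (a b : A) : T B (B.circ a b) = T B a * T B b := by
  ext m
  · simp [T_apply, lam_circ]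
  · simp [T_apply]
  · simp [T_apply, lam_apply, B.circ_assoc]
  · simp [T_apply]

theorem T_zero : T B 0 = 1 := by
  ext m
  all_goals simp [T_apply, lam_zero]

theorem T_pow (a : A) (k : ℕ) : T B (circPow B a k) = T B a ^ k := by
  induction k with
  | zero => rw [circPow, one_eq, T_zero, pow_zero]
  | succ k ih => rw [circPow, T_circ, ih, pow_succ']

theorem T_pt (a : A) : T B a (0, 1) = (a, 1) := by simp [T_apply]

/-- T - 1 -/
def U (a : A) : Module.End ℤ (A × ℤ) := T B a - 1

theorem T_eq (a : A) : T B a = 1 + U B a := by simp [U]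

theorem U_apply (a : A) (m : A × ℤ) : U B a m = (B.star a m.1 + m.2 • a, 0) := by
  rw [U, LinearMap.sub_apply, T_apply, Module.End.one_apply, star_eq]
  ext
  · simp only [Prod.fst_sub]; abel
  · simp

theorem U_pow (a : A) (i : ℕ) : (U B a ^ (i+1)) (0, 1) = (eSeq B a i, 0) := by
  induction i with
  | zero => simp [U_apply, eSeq, star_eq]
  | succ i ih => rw [pow_succ', Module.End.mul_apply, ih, U_apply]; simp [eSeq]

/-- filtration of the module -/
def W : ℕ → AddSubgroup (A × ℤ)
  | 0 => ⊥
  | i + 1 => ⨅ a, (W i).comap (U B a).toAddMonoidHom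

theorem mem_W_succ {i : ℕ} {m : A × ℤ} : m ∈ W B (i+1) ↔ ∀ a, U B a m ∈ W B i := by
  simp [W, AddSubgroup.mem_iInf]

theorem V_W (i : ℕ) (v : A) (hv : v ∈ V B i) : ((v, 0) : A × ℤ) ∈ W B i := by
  induction i generalizing v with
  | zero =>
    have : v = 0 := by simpa [V] using hv
    subst this; exact (W B 0).zero_mem
  | succ i ih =>
    rw [mem_W_succ]; intro a
    rw [U_apply]
    simpa using ih _ (hv a)

theorem W_top {p n : ℕ} (hp : p.Prime) (hcard : Nat.card A = p ^ n) (k : ℕ) (hk : n + 1 ≤ k)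
    (m : A × ℤ) : m ∈ W B k := by
  induction k, hk using Nat.le_induction generalizing m with
  | base =>
    rw [mem_W_succ]; intro a; rw [U_apply]
    apply V_W; rw [V_top B hp hcard]; trivial
  | succ k hk ih => rw [mem_W_succ]; intro a; exact ih _

/-- filtration of the endomorphism ring -/
def P (k : ℕ) : AddSubgroup (Module.End ℤ (A × ℤ)) where
  carrier := {φ | ∀ j, ∀ m ∈ W B (j + k), φ m ∈ W B j}
  zero_mem' := by intro j m _; simp
  add_mem' := by
    intro φ ψ h1 h2 j m hm
    exact (W B j).add_mem (h1 j m hm) (h2 j m hm)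
  neg_mem' := by
    intro φ h1 j m hm
    exact (W B j).neg_mem (h1 j m hm)

theorem P_one : (1 : Module.End ℤ (A × ℤ)) ∈ P B 0 := fun _ _ hm => hm

theorem P_mul : ∀ j l x y, x ∈ P B j → y ∈ P B l → x * y ∈ P B (j + l) := by
  intro j l x y hx hy i m hm
  rw [← add_assoc] at hm
  exact hx _ _ (hy _ _ hm)

theorem P_U (a : A) : U B a ∈ P B 1 := fun _ _ hm => (mem_W_succ B).1 hm a

theorem P_zero {p n : ℕ} (hp : p.Prime) (hcard : Nat.card A = p ^ n) :
    ∀ k, n + 1 ≤ k → ∀ x ∈ P B k, x = 0 := by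
  intro k hk x hx
  refine LinearMap.ext fun m => ?_
  have := hx 0 m (by rw [zero_add]; exact W_top B hp hcard k hk m)
  simpa [W] using this

variable {p n : ℕ} (hp : p.Prime) (hpn : n + 1 < p) (hcard : Nat.card A = p ^ n)
include hp hpn hcard

theorem U_pow_p (a : A) : U B a ^ p = 0 :=
  P_zero B hp hcard p hpn.le _ (filt_pow _ (P_one B) (P_mul B) (P_U B a) p)

theorem U_cancel (a b : A) (q k : ℕ)
    (h : q • gg (fun i => (p ^ k).choose i / p ^ k) (p - 1) (U B a)
      = q • gg (fun i => (p ^ k).choose i / p ^ k) (p - 1) (U B b)) :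
    q • (U B a - U B b) = 0 :=
  cancel (P B) (P_one B) (P_mul B) (n+1) (P_zero B hp hcard) (P_U B a) (P_U B b) q _
    (by simp [Nat.div_self (pow_pos hp.pos k)]) _ (by have := hp.two_le; omega) h

theorem U_zero' : U B 0 = 0 := by rw [U, T_zero, sub_self]

theorem ann_U (k : ℕ) (hk : 1 ≤ k) (x : A) (hx : p ^ k • x = 0) : p ^ k • U B x = 0 := by
  have e := one_add_pow hp k hk (U B x) (U_pow_p B hp hpn hcard x)
  have hpt : (p ^ k • gg (fun i => (p ^ k).choose i / p ^ k) (p - 1) (U B x)) (0, 1) = 0 := by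
    unfold gg
    rw [Finset.smul_sum, LinearMap.sum_apply]
    refine Finset.sum_eq_zero fun i hi => ?_
    obtain ⟨i, rfl⟩ : ∃ i', i = i' + 1 := ⟨i - 1, by simp at hi; omega⟩
    rw [smul_comm, LinearMap.smul_apply, LinearMap.smul_apply, pow_succ, Module.End.mul_apply,
      U_apply, ← map_nsmul]
    have h0 : p ^ k • ((B.star x ((0, 1) : A × ℤ).1 + ((0, 1) : A × ℤ).2 • x, 0) : A × ℤ) = 0 := by
      simp [star_eq, hx]
    rw [h0, map_zero, smul_zero]
  rw [← T_eq, ← T_pow] at e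
  have h0 : circPow B x (p ^ k) = 0 := by
    have := T_pt B (circPow B x (p ^ k))
    rw [e, LinearMap.add_apply, hpt] at this
    simpa using (congrArg Prod.fst this).symm
  rw [h0, T_zero] at e
  have e' := (left_eq_add.1 e)
  have := U_cancel B hp hpn hcard x 0 (p ^ k) k (by
    rw [e', U_zero' B hp hpn hcard]
    unfold gg
    rw [Finset.sum_eq_zero, smul_zero]
    intro i hi
    rw [zero_pow (by simp at hi; omega), smul_zero])
  rwa [U_zero' B hp hpn hcard, sub_zero] at this

theorem ann_sub (k : ℕ) (hk : 1 ≤ k) (c d : A) (h : p ^ k • (c - d) = 0) :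
    p ^ k • U B c = p ^ k • U B d := by
  letI : Group A := circGroup B
  have hinv : B.circ d (B.inv d) = B.one := mul_inv_cancel d
  set x := B.circ (B.inv d) c with hxd
  have hc : c = B.circ d x := by
    rw [hxd, ← B.circ_assoc, hinv, B.one_circ]
  have h1 : lam B d x = c - d := by rw [lam_apply, ← hc]
  have h2 : x = lam B (B.inv d) (c - d) := by
    rw [← h1, ← lam_circ, B.inv_circ, one_eq, lam_zero]
  have h3 : p ^ k • x = 0 := by rw [h2, ← map_nsmul, h, map_zero]
  have h4 := ann_U B hp hpn hcard k hk x h3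
  have h5 : T B c = T B d + T B d * U B x := by
    conv_lhs => rw [hc, T_circ, T_eq B x, mul_add, mul_one]
  have h6 : p ^ k • T B c = p ^ k • T B d := by
    rw [h5, smul_add, ← mul_smul_comm, h4, mul_zero, add_zero]
  simp only [U, smul_sub, h6]

theorem gg_pt (a : A) : gg (fun i => (p ^ 1).choose i / p ^ 1) (p - 1) (U B a) (0, 1)
    = (fMap B p a, 0) := by
  unfold gg fMap
  rw [LinearMap.sum_apply]
  have : ∀ i ∈ Finset.Icc 1 (p - 1), (((p ^ 1).choose i / p ^ 1) • U B a ^ i) (0, 1)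
      = AddMonoidHom.inl A ℤ ((Nat.choose (p - 1) (i - 1) / i) • eSeq B a (i - 1)) := by
    intro i hi
    have hi' : 1 ≤ i ∧ i < p := by simp at hi; omega
    have hd := dvd_choose hp 1 i hi'.1 hi'.2
    rw [pow_one] at *
    have h := Nat.add_one_mul_choose_eq (p - 1) (i - 1)
    rw [Nat.sub_add_cancel hp.one_le, Nat.sub_add_cancel hi'.1] at h
    obtain ⟨r, hr⟩ := hd
    have h1 : p.choose i / p = r := by rw [hr, Nat.mul_div_cancel_left _ hp.pos]
    have h2 : (p - 1).choose (i - 1) / i = r := by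
      rw [hr, mul_assoc] at h
      rw [Nat.eq_of_mul_eq_mul_left hp.pos h, Nat.mul_div_cancel _ hi'.1]
    rw [h1, h2, LinearMap.smul_apply]
    obtain ⟨i, rfl⟩ : ∃ i', i = i' + 1 := ⟨i - 1, by omega⟩
    rw [U_pow]; simp
  rw [Finset.sum_congr rfl this, ← map_sum]; rfl

theorem fwd (a b : A) (h : p ^ 2 • (a - b) = 0) : p ^ 2 • (fMap B p a - fMap B p b) = 0 := by
  have h1 := ann_sub B hp hpn hcard 2 (by norm_num) a b h
  have h2 := smul_gg_eq h1 (fun i => (p ^ 1).choose i / p ^ 1) (p - 1)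
  have h3 := congrArg (fun φ : Module.End ℤ (A × ℤ) => (φ (0, 1)).1) h2
  simp only [LinearMap.smul_apply, gg_pt B hp hpn hcard] at h3
  rw [smul_sub, sub_eq_zero]
  simpa using h3

theorem bwd (a b : A) (h : p ^ 2 • (fMap B p a - fMap B p b) = 0) : p ^ 2 • (a - b) = 0 := by
  have e : ∀ a, T B (circPow B a (p ^ 1)) = 1 + p ^ 1 •
      gg (fun i => (p ^ 1).choose i / p ^ 1) (p - 1) (U B a) := by
    intro a
    rw [T_pow, T_eq, one_add_pow hp 1 le_rfl _ (U_pow_p B hp hpn hcard a)]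
  have hc : ∀ a, circPow B a (p ^ 1) = p ^ 1 • fMap B p a := by
    intro a
    have := T_pt B (circPow B a (p ^ 1))
    rw [e a, LinearMap.add_apply, LinearMap.smul_apply, gg_pt B hp hpn hcard] at this
    simpa using (congrArg Prod.fst this).symm
  have h1 := ann_sub B hp hpn hcard 1 le_rfl (circPow B a (p ^ 1)) (circPow B b (p ^ 1)) (by
    rw [hc, hc, ← smul_sub, smul_smul, ← pow_add]; exact h)
  rw [U, U, e, e, add_sub_cancel_left, add_sub_cancel_left, smul_smul, smul_smul, ← pow_add] at h1
  have h2 := U_cancel B hp hpn hcard a b (p ^ 2) 1 h1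
  have h3 := congrArg (fun φ : Module.End ℤ (A × ℤ) => (φ (0, 1)).1) h2
  simp only [LinearMap.smul_apply, LinearMap.sub_apply, U_apply] at h3
  simpa [star_eq] using h3

end brace

end BraceAux

/-- the map `[a] ↦ [f(a)]` is a well-defined bijection of `A/ann(p²)`;
in particular `f(a) − f(b) ∈ ann(p²)` implies `a − b ∈ ann(p²)`. -/
theorem stmt_7 (p n : ℕ) (hp : p.Prime) (hpn : n + 1 < p)
    (A : Type u) [AddCommGroup A] (B : LeftBrace A) (hcard : Nat.card A = p ^ n) :
    (∃ F : (A ⧸ annSub A (p ^ 2)) → (A ⧸ annSub A (p ^ 2)),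
      (∀ a : A, F (qmk (p ^ 2) a) = qmk (p ^ 2) (fMap B p a)) ∧ Function.Bijective F) ∧
    (∀ a b : A, fMap B p a - fMap B p b ∈ annSub A (p ^ 2) → a - b ∈ annSub A (p ^ 2)) := by
  have hmem : ∀ x : A, x ∈ annSub A (p ^ 2) ↔ p ^ 2 • x = 0 := fun x => Iff.rfl
  have hb := BraceAux.bwd B hp hpn hcard
  have hf := BraceAux.fwd B hp hpn hcard
  have hq : ∀ x y : A, qmk (p ^ 2) x = qmk (p ^ 2) y ↔ p ^ 2 • (x - y) = 0 := by
    intro x y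
    unfold qmk
    rw [QuotientAddGroup.eq_iff_sub_mem, hmem]
  haveI : Finite A := Nat.finite_of_card_ne_zero (by rw [hcard]; exact (pow_pos hp.pos n).ne')
  refine ⟨⟨fun q => qmk (p ^ 2) (fMap B p q.out), ?_, ?_⟩, fun a b h => hb a b h⟩
  · intro a
    rw [hq]
    apply hf
    rw [← hq]
    exact Quotient.out_eq _
  · rw [← Finite.injective_iff_bijective]
    intro x y hxy
    have := (hq _ _).2 (hb _ _ ((hq _ _).1 hxy))
    have hx : qmk (p ^ 2) x.out = x := Quotient.out_eq _
    have hy : qmk (p ^ 2) y.out = y := Quotient.out_eq _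
    rw [← hx, ← hy, this]
end
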